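/- arXiv:2001.05368 — 2 statements merged into one kernel-verified Lean document; each statement's English description precedes it below -/
import Mathlib

section
/- Existence of minimizers: given h < 0, α ∈ (0,2), V(x)=|x|^{−α}U(x/|x|) with U continuous positive, and q with 0 < |q| < r_LJ, the Maupertuis functional M_h attains its minimum on H_coll^q = {u ∈ H¹([0,1];ℝ²) : u(0)=q, u(1)=0, |u| ≤ |q|}, and the minimum value is positive. -/
open Set MeasureTheory intervalIntegral

noncomputable def Vpot (α : ℝ) (U : EuclideanSpace ℝ (Fin 2) → ℝ)
    (x : EuclideanSpace ℝ (Fin 2)) : ℝ :=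
  ‖x‖ ^ (-α) * U (‖x‖⁻¹ • x)

/-- The Maupertuis functional `M_h(u) = (1/2)∫₀¹|u̇|² · ∫₀¹(h+V(u))`. -/
noncomputable def Maupertuis (α h : ℝ) (U : EuclideanSpace ℝ (Fin 2) → ℝ)
    (u : ℝ → EuclideanSpace ℝ (Fin 2)) : ℝ :=
  ((1/2) * ∫ s in (0:ℝ)..1, ‖deriv u s‖ ^ 2) *
    (∫ s in (0:ℝ)..1, (h + Vpot α U (u s)))

/-- The class `H_coll^q` of (H¹) collision paths from `q` to `0` staying in the ball
of radius `|q|` (with finite Maupertuis functional). -/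
def HcollQ (α h : ℝ) (U : EuclideanSpace ℝ (Fin 2) → ℝ)
    (q : EuclideanSpace ℝ (Fin 2)) (u : ℝ → EuclideanSpace ℝ (Fin 2)) : Prop :=
  ContinuousOn u (Icc 0 1) ∧ (∀ s ∈ Ioo (0:ℝ) 1, DifferentiableAt ℝ u s) ∧
    u 0 = q ∧ u 1 = 0 ∧ (∀ s ∈ Icc (0:ℝ) 1, ‖u s‖ ≤ ‖q‖) ∧
    (∀ᵐ s, s ∈ Icc (0:ℝ) 1 → u s ≠ 0) ∧
    IntervalIntegrable (fun s => ‖deriv u s‖ ^ 2) volume 0 1 ∧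
    IntervalIntegrable (fun s => h + Vpot α U (u s)) volume 0 1


abbrev E2 := EuclideanSpace ℝ (Fin 2)

open Filter Topology

/-- Domination criterion for absolute continuity. -/
lemma ac_of_dist_le {X Y : Type*} [PseudoMetricSpace X] [PseudoMetricSpace Y]
    {f : ℝ → X} {g : ℝ → Y} {a b C : ℝ}
    (hf : AbsolutelyContinuousOnInterval f a b)
    (hle : ∀ s ∈ uIcc a b, ∀ t ∈ uIcc a b, dist (g s) (g t) ≤ C * dist (f s) (f t)) :
    AbsolutelyContinuousOnInterval g a b := by
  unfold AbsolutelyContinuousOnInterval at hf ⊢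
  refine squeeze_zero' (Eventually.of_forall fun _ => Finset.sum_nonneg fun i _ => dist_nonneg) ?_
    (by simpa using hf.const_mul C)
  rw [eventually_inf_principal]
  filter_upwards with ⟨n, I⟩ hnI
  simp only [Finset.mul_sum]
  apply Finset.sum_le_sum
  intro i hi
  simp only [AbsolutelyContinuousOnInterval.disjWithin, mem_ofPred_eq] at hnI
  exact hle _ (hnI.1 i hi).1 _ (hnI.1 i hi).2

lemma ac_integral {f : ℝ → E2} {a b : ℝ} (hf : IntervalIntegrable f volume a b) :
    AbsolutelyContinuousOnInterval (fun x => ∫ v in a..x, f v) a b := by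
  have h1 := hf.norm.absolutelyContinuousOnInterval_intervalIntegral (c := a) (by simp)
  refine ac_of_dist_le (C := 1) h1 ?_
  intro s hs t ht
  have hs' : IntervalIntegrable f volume a s := hf.mono_set (uIcc_subset_uIcc_left hs)
  have ht' : IntervalIntegrable f volume a t := hf.mono_set (uIcc_subset_uIcc_left ht)
  rw [one_mul, dist_eq_norm, dist_eq_norm, integral_interval_sub_left hs' ht',
    integral_interval_sub_left hs'.norm ht'.norm]
  exact norm_integral_le_abs_integral_norm

lemma ac_ae_diff {f : ℝ → E2} {a b : ℝ} (hf : AbsolutelyContinuousOnInterval f a b) :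
    ∀ᵐ x, x ∈ uIcc a b → DifferentiableAt ℝ f x :=
  hf.boundedVariationOn.ae_differentiableAt_of_mem_uIcc

/-- FTC. -/
lemma ac_ftc {F f : ℝ → E2} {a b : ℝ} (hF : AbsolutelyContinuousOnInterval F a b)
    (hf : IntervalIntegrable f volume a b) (hd : ∀ᵐ x, x ∈ uIcc a b → HasDerivAt F (f x) x) :
    ∫ x in a..b, f x = F b - F a := by
  let g (x : ℝ) := F x - ∫ t in a..x, f t
  have g_ac : AbsolutelyContinuousOnInterval g a b := hF.sub (ac_integral hf)
  have g0 : ∀ᵐ x, x ∈ uIcc a b → HasDerivAt g 0 x := by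
    filter_upwards [hd, hf.ae_hasDerivAt_integral] with x hx₁ hx₂ hx₃
    have := (hx₁ hx₃).sub (hx₂ hx₃ a (by simp))
    rw [sub_self] at this
    exact this
  obtain ⟨C, hC⟩ := g_ac.const_of_ae_hasDerivAt_zero g0
  have h1 := hC a (by simp)
  have h2 := hC b (by simp)
  simp only [g, intervalIntegral.integral_same, sub_zero] at h1 h2
  rw [h1, ← h2]; abel

/-- real FTC with a.e. derivative. -/
lemma ac_ftc_real {F f : ℝ → ℝ} {a b : ℝ} (hF : AbsolutelyContinuousOnInterval F a b)
    (hd : ∀ᵐ x, x ∈ uIcc a b → HasDerivAt F (f x) x) :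
    ∫ x in a..b, f x = F b - F a := by
  rw [← hF.integral_deriv_eq_sub]
  apply intervalIntegral.integral_congr_ae
  filter_upwards [hd] with x hx hx'
  exact ((hx (uIoc_subset_uIcc hx')).deriv).symm

lemma ii_of_sq {w : ℝ → E2} {a b : ℝ} (hm : AEStronglyMeasurable w (volume.restrict (uIoc a b)))
    (h : IntervalIntegrable (fun s => ‖w s‖ ^ 2) volume a b) : IntervalIntegrable w volume a b := by
  have h1 : IntervalIntegrable (fun s => 1 + ‖w s‖ ^ 2) volume a b :=
    intervalIntegrable_const.add h
  refine h1.mono_fun hm (Eventually.of_forall fun s => ?_)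
  simp only
  rw [Real.norm_of_nonneg (by positivity)]
  nlinarith [sq_nonneg (‖w s‖ - 1), norm_nonneg (w s)]

/-- From an integral representation, get AC and a.e. derivative. -/
lemma ac_of_rep {u w : ℝ → E2} {q : E2} (hw : IntervalIntegrable w volume 0 1)
    (hu : ∀ t ∈ Icc (0:ℝ) 1, u t = q + ∫ s in (0:ℝ)..t, w s) :
    AbsolutelyContinuousOnInterval u 0 1 ∧
      (∀ᵐ t, t ∈ Icc (0:ℝ) 1 → HasDerivAt u (w t) t) := by
  constructor
  · refine ac_of_dist_le (C := 1) (ac_integral hw) ?_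
    intro s hs t ht
    rw [uIcc_of_le zero_le_one] at hs ht
    rw [hu s hs, hu t ht]; simp
  · have h₁ : ∀ᵐ x : ℝ, x ≠ 0 := by simp [ae_iff, measure_singleton]
    have h₂ : ∀ᵐ x : ℝ, x ≠ 1 := by simp [ae_iff, measure_singleton]
    filter_upwards [h₁, h₂, hw.ae_hasDerivAt_integral] with t ht0 ht1 hd ht
    have ht' : t ∈ Ioo (0:ℝ) 1 := ⟨lt_of_le_of_ne ht.1 (Ne.symm ht0), lt_of_le_of_ne ht.2 ht1⟩
    rw [uIcc_of_le zero_le_one] at hd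
    have h3 := (hd ht 0 (by simp)).const_add q
    refine h3.congr_of_eventuallyEq ?_
    filter_upwards [Ioo_mem_nhds ht'.1 ht'.2] with s hs
    exact hu s (Ioo_subset_Icc_self hs)

/-- The relaxed class. -/
structure HcA (α h : ℝ) (U : E2 → ℝ) (q : E2) (u : ℝ → E2) : Prop where
  ac : AbsolutelyContinuousOnInterval u 0 1
  u0 : u 0 = q
  u1 : u 1 = 0
  bd : ∀ s ∈ Icc (0:ℝ) 1, ‖u s‖ ≤ ‖q‖
  nz : ∀ᵐ s, s ∈ Icc (0:ℝ) 1 → u s ≠ 0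
  iK : IntervalIntegrable (fun s => ‖deriv u s‖ ^ 2) volume 0 1
  iP : IntervalIntegrable (fun s => h + Vpot α U (u s)) volume 0 1

lemma HcA.cont {α h : ℝ} {U : E2 → ℝ} {q : E2} {u : ℝ → E2} (H : HcA α h U q u) :
    ContinuousOn u (Icc 0 1) := by
  simpa [uIcc_of_le] using H.ac.continuousOn

lemma HcA.iw {α h : ℝ} {U : E2 → ℝ} {q : E2} {u : ℝ → E2} (H : HcA α h U q u) :
    IntervalIntegrable (deriv u) volume 0 1 :=
  ii_of_sq (stronglyMeasurable_deriv u).aestronglyMeasurable H.iK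

lemma ii_sub {F : Type*} [NormedAddCommGroup F] {f : ℝ → F} (hf : IntervalIntegrable f volume 0 1)
    {s t : ℝ} (hs : s ∈ Icc (0:ℝ) 1) (ht : t ∈ Icc (0:ℝ) 1) : IntervalIntegrable f volume s t :=
  hf.mono_set (uIcc_subset_uIcc (by rwa [uIcc_of_le zero_le_one]) (by rwa [uIcc_of_le zero_le_one]))

lemma HcA.der {α h : ℝ} {U : E2 → ℝ} {q : E2} {u : ℝ → E2} (H : HcA α h U q u) :
    ∀ᵐ t, t ∈ Icc (0:ℝ) 1 → HasDerivAt u (deriv u t) t := by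
  filter_upwards [ac_ae_diff H.ac] with t h1 h2
  exact (h1 (by rwa [uIcc_of_le zero_le_one])).hasDerivAt

lemma HcA.ftc {α h : ℝ} {U : E2 → ℝ} {q : E2} {u : ℝ → E2} (H : HcA α h U q u)
    {s t : ℝ} (hs : s ∈ Icc (0:ℝ) 1) (ht : t ∈ Icc (0:ℝ) 1) :
    ∫ x in s..t, deriv u x = u t - u s := by
  have hsub : uIcc s t ⊆ uIcc 0 1 :=
    uIcc_subset_uIcc (by rwa [uIcc_of_le zero_le_one]) (by rwa [uIcc_of_le zero_le_one])
  refine ac_ftc (H.ac.mono hsub) (ii_sub H.iw hs ht) ?_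
  filter_upwards [H.der] with x hx hx'
  exact hx (by simpa [uIcc_of_le] using hsub hx')

lemma hcA_of_rep {α h : ℝ} {U : E2 → ℝ} {q : E2} {u w : ℝ → E2}
    (hw : IntervalIntegrable w volume 0 1)
    (hw2 : IntervalIntegrable (fun s => ‖w s‖ ^ 2) volume 0 1)
    (hu : ∀ t ∈ Icc (0:ℝ) 1, u t = q + ∫ s in (0:ℝ)..t, w s)
    (u1 : u 1 = 0) (bd : ∀ s ∈ Icc (0:ℝ) 1, ‖u s‖ ≤ ‖q‖)
    (nz : ∀ᵐ s, s ∈ Icc (0:ℝ) 1 → u s ≠ 0)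
    (iP : IntervalIntegrable (fun s => h + Vpot α U (u s)) volume 0 1) :
    HcA α h U q u ∧ ∫ s in (0:ℝ)..1, ‖deriv u s‖ ^ 2 = ∫ s in (0:ℝ)..1, ‖w s‖ ^ 2 := by
  obtain ⟨h1, h2⟩ := ac_of_rep hw hu
  have h3 : ∀ᵐ x, x ∈ uIoc (0:ℝ) 1 → ‖w x‖ ^ 2 = ‖deriv u x‖ ^ 2 := by
    filter_upwards [h2] with x hx hx'
    rw [uIoc_of_le zero_le_one] at hx'
    rw [(hx (Ioc_subset_Icc_self hx')).deriv]
  refine ⟨⟨h1, by simpa using hu 0 (by simp), u1, bd, nz, ?_, iP⟩, ?_⟩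
  · exact hw2.congr_ae ((ae_restrict_iff' measurableSet_uIoc).2 h3)
  · symm; exact intervalIntegral.integral_congr_ae h3

lemma hcA_of_hcollQ {α h : ℝ} {U : E2 → ℝ} {q : E2} {u : ℝ → E2} (H : HcollQ α h U q u) :
    HcA α h U q u := by
  obtain ⟨hc, hd, h0, h1, hb, hnz, hK, hP⟩ := H
  have hw : IntervalIntegrable (deriv u) volume 0 1 :=
    ii_of_sq (stronglyMeasurable_deriv u).aestronglyMeasurable hK
  refine (hcA_of_rep hw hK ?_ h1 hb hnz hP).1
  intro t ht
  rw [integral_eq_sub_of_hasDeriv_right (f := u), h0]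
  · abel
  · rw [uIcc_of_le ht.1]; exact hc.mono (Icc_subset_Icc_right ht.2)
  · intro x hx
    rw [min_eq_left ht.1, max_eq_right ht.1] at hx
    exact (hd x ⟨hx.1, hx.2.trans_le ht.2⟩).hasDerivAt.hasDerivWithinAt
  · exact ii_sub hw (by simp) ht

/-- The standing hypotheses. -/
structure Hyp (α h Umin : ℝ) (U : E2 → ℝ) (q : E2) : Prop where
  hα : α ∈ Set.Ioo (0:ℝ) 2
  hh : h < 0
  hU : Continuous U
  hm : ∀ s : E2, ‖s‖ = 1 → Umin ≤ U s
  hp : 0 < Umin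
  hq : q ≠ 0
  hr : ‖q‖ < ((2 - α) * Umin / (-2 * h)) ^ (1/α)

lemma vpot_hom {α : ℝ} {U : E2 → ℝ} {c : ℝ} (hc : 0 < c) (x : E2) :
    Vpot α U (c • x) = c ^ (-α) * Vpot α U x := by
  unfold Vpot
  have h1 : ‖c • x‖⁻¹ • c • x = ‖x‖⁻¹ • x := by
    rw [norm_smul, Real.norm_of_nonneg hc.le, smul_smul, mul_inv]
    congr 1
    field_simp
  rw [h1, norm_smul, Real.norm_of_nonneg hc.le, Real.mul_rpow hc.le (norm_nonneg x)]
  ring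

lemma vpot_meas {α : ℝ} {U : E2 → ℝ} (hU : Continuous U) : Measurable (Vpot α U) := by
  unfold Vpot
  have : Measurable fun x : E2 => ‖x‖⁻¹ • x := by fun_prop
  exact (measurable_norm.pow_const _).mul (hU.measurable.comp this)

lemma vpot_cont {α : ℝ} {U : E2 → ℝ} (hU : Continuous U) {x : E2} (hx : x ≠ 0) :
    ContinuousAt (Vpot α U) x := by
  unfold Vpot
  have hx' : ‖x‖ ≠ 0 := norm_ne_zero_iff.2 hx
  refine ContinuousAt.mul ?_ ?_
  · exact continuous_norm.continuousAt.rpow_const (Or.inl hx')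
  · refine hU.continuousAt.comp ?_
    exact (continuous_norm.continuousAt.inv₀ hx').smul continuousAt_id

namespace Hyp

variable {α h Umin : ℝ} {U : E2 → ℝ} {q : E2}

lemma v_lb (H : Hyp α h Umin U q) {x : E2} (hx : x ≠ 0) : Umin * ‖x‖ ^ (-α) ≤ Vpot α U x := by
  unfold Vpot
  have h1 : ‖‖x‖⁻¹ • x‖ = 1 := by
    rw [norm_smul, norm_inv, norm_norm]
    exact inv_mul_cancel₀ (norm_ne_zero_iff.2 hx)
  have := H.hm _ h1
  have h2 : 0 ≤ ‖x‖ ^ (-α) := by positivity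
  nlinarith

lemma v_nn (H : Hyp α h Umin U q) (x : E2) : 0 ≤ Vpot α U x := by
  by_cases hx : x = 0
  · subst hx
    unfold Vpot
    rw [norm_zero, Real.zero_rpow (by linarith [H.hα.1]), zero_mul]
  · refine le_trans ?_ (H.v_lb hx)
    have := H.hp
    positivity

lemma q_bd (H : Hyp α h Umin U q) : -2 * h < (2 - α) * Umin * ‖q‖ ^ (-α) := by
  have hq : 0 < ‖q‖ := norm_pos_iff.2 H.hq
  have h0 := H.hα
  have hh := H.hh
  have hp := H.hp
  have hX : 0 < (2 - α) * Umin / (-2 * h) := by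
    apply div_pos
    · exact mul_pos (by linarith [h0.2]) hp
    · linarith
  have h1 : ‖q‖ ^ α < (2 - α) * Umin / (-2 * h) := by
    have := Real.rpow_lt_rpow hq.le H.hr h0.1
    rwa [← Real.rpow_mul hX.le, one_div, inv_mul_cancel₀ h0.1.ne', Real.rpow_one] at this
  rw [Real.rpow_neg hq.le, ← div_eq_mul_inv, lt_div_iff₀ (by positivity)]
  rw [lt_div_iff₀ (by linarith)] at h1
  linarith

lemma v_lb' (H : Hyp α h Umin U q) {x : E2} (hx : x ≠ 0) (hxq : ‖x‖ ≤ ‖q‖) :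
    Umin * ‖q‖ ^ (-α) ≤ Vpot α U x := by
  refine le_trans ?_ (H.v_lb hx)
  have := Real.rpow_le_rpow_of_nonpos (norm_pos_iff.2 hx) hxq (by linarith [H.hα.1] : -α ≤ 0)
  exact mul_le_mul_of_nonneg_left this H.hp.le

lemma v_key (H : Hyp α h Umin U q) {x : E2} (hx : x ≠ 0) (hxq : ‖x‖ ≤ ‖q‖) :
    0 < 2 * h + (2 - α) * Vpot α U x := by
  have h1 := H.v_lb' hx hxq
  have h2 := H.q_bd
  have h3 := H.hα.2
  nlinarith

lemma δ_pos (H : Hyp α h Umin U q) : 0 < h + Umin * ‖q‖ ^ (-α) := by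
  have h2 := H.q_bd
  have h3 := H.hα.1
  have : 0 < Umin * ‖q‖ ^ (-α) := mul_pos H.hp (Real.rpow_pos_of_pos (norm_pos_iff.2 H.hq) _)
  nlinarith

lemma δ_le (H : Hyp α h Umin U q) {x : E2} (hx : x ≠ 0) (hxq : ‖x‖ ≤ ‖q‖) :
    h + Umin * ‖q‖ ^ (-α) ≤ h + Vpot α U x := by
  linarith [H.v_lb' hx hxq]

end Hyp

/-- kinetic part -/
noncomputable def Kf (u : ℝ → E2) : ℝ := (1/2) * ∫ s in (0:ℝ)..1, ‖deriv u s‖ ^ 2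
/-- potential part -/
noncomputable def Pf (α h : ℝ) (U : E2 → ℝ) (u : ℝ → E2) : ℝ :=
  ∫ s in (0:ℝ)..1, (h + Vpot α U (u s))

lemma maup_eq (α h : ℝ) (U : E2 → ℝ) (u : ℝ → E2) : Maupertuis α h U u = Kf u * Pf α h U u := rfl

/-- Cauchy-Schwarz -/
lemma cs_int {w : ℝ → E2} {s t : ℝ} (hst : s < t) (hw : IntervalIntegrable w volume s t)
    (hw2 : IntervalIntegrable (fun x => ‖w x‖ ^ 2) volume s t) :
    ‖∫ x in s..t, w x‖ ^ 2 ≤ (t - s) * ∫ x in s..t, ‖w x‖ ^ 2 := by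
  set D := ∫ x in s..t, w x with hD
  have hts : 0 < t - s := by linarith
  have h1 : ∫ x in s..t, inner ℝ D (w x) = ‖D‖ ^ 2 := by
    have := (innerSL ℝ D).intervalIntegral_comp_comm hw
    simp only [innerSL_apply_apply] at this
    rw [this, ← hD, real_inner_self_eq_norm_sq]
  have hi : IntervalIntegrable (fun x => inner ℝ D (w x)) volume s t :=
    ⟨(innerSL ℝ D).integrable_comp hw.1, (innerSL ℝ D).integrable_comp hw.2⟩
  have h2 : 0 ≤ ∫ x in s..t, ((t-s)^2 * ‖w x‖ ^ 2 - (2 * (t-s)) * inner ℝ D (w x) + ‖D‖^2) := by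
    apply intervalIntegral.integral_nonneg hst.le
    intro x _
    have h3 : ‖(t-s) • w x - D‖ ^ 2 = (t-s)^2 * ‖w x‖ ^ 2 - (2 * (t-s)) * inner ℝ D (w x) + ‖D‖^2 := by
      rw [norm_sub_sq_real, norm_smul, inner_smul_left, real_inner_comm, mul_pow]
      simp [sq_abs]; ring
    rw [← h3]; positivity
  rw [intervalIntegral.integral_add ((hw2.const_mul _).sub (hi.const_mul _)) intervalIntegrable_const,
    intervalIntegral.integral_sub (hw2.const_mul _) (hi.const_mul _),
    intervalIntegral.integral_const_mul, intervalIntegral.integral_const_mul, h1,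
    intervalIntegral.integral_const, smul_eq_mul] at h2
  have h4 : 0 ≤ (t-s) * ((t - s) * (∫ x in s..t, ‖w x‖ ^ 2) - ‖D‖^2) := by nlinarith
  have := nonneg_of_mul_nonneg_right h4 hts
  linarith

namespace HcA

variable {α h Umin : ℝ} {U : E2 → ℝ} {q : E2} {u : ℝ → E2}

lemma cs (A : HcA α h U q u) {s t : ℝ} (hst : s < t) (hs : s ∈ Icc (0:ℝ) 1) (ht : t ∈ Icc (0:ℝ) 1) :
    ‖u t - u s‖ ^ 2 ≤ (t - s) * ∫ x in s..t, ‖deriv u x‖ ^ 2 := by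
  rw [← A.ftc hs ht]
  exact cs_int hst (ii_sub A.iw hs ht) (ii_sub A.iK hs ht)

lemma K_lb (A : HcA α h U q u) : ‖q‖ ^ 2 / 2 ≤ Kf u := by
  have := A.cs zero_lt_one (by simp) (by simp)
  rw [A.u0, A.u1] at this
  simp at this
  unfold Kf; linarith

lemma K_pos (H : Hyp α h Umin U q) (A : HcA α h U q u) : 0 < Kf u := by
  have := A.K_lb
  have hq : 0 < ‖q‖ := norm_pos_iff.2 H.hq
  have : 0 < ‖q‖ ^ 2 := by positivity
  linarith

lemma ae_lb (H : Hyp α h Umin U q) (A : HcA α h U q u) :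
    ∀ᵐ s, s ∈ Icc (0:ℝ) 1 → h + Umin * ‖q‖ ^ (-α) ≤ h + Vpot α U (u s) := by
  filter_upwards [A.nz] with s hs hs'
  exact H.δ_le (hs hs') (A.bd s hs')

lemma P_lb (H : Hyp α h Umin U q) (A : HcA α h U q u) :
    h + Umin * ‖q‖ ^ (-α) ≤ Pf α h U u := by
  have h1 : ∫ s in (0:ℝ)..1, (h + Umin * ‖q‖ ^ (-α)) ≤ Pf α h U u := by
    refine intervalIntegral.integral_mono_ae_restrict zero_le_one intervalIntegrable_const A.iP ?_
    exact (ae_restrict_iff' measurableSet_Icc).2 (A.ae_lb H)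
  simpa using h1

lemma P_pos (H : Hyp α h Umin U q) (A : HcA α h U q u) : 0 < Pf α h U u :=
  H.δ_pos.trans_le (A.P_lb H)

lemma iV (A : HcA α h U q u) : IntervalIntegrable (fun s => Vpot α U (u s)) volume 0 1 := by
  simpa using A.iP.sub (intervalIntegrable_const (c := h))

end HcA

section

lemma weak_seq {H : Type*} [NormedAddCommGroup H] [InnerProductSpace ℝ H] [CompleteSpace H]
    [TopologicalSpace.SeparableSpace H] (x : ℕ → H) (R : ℝ) (hx : ∀ n, ‖x n‖ ≤ R) :
    ∃ y : H, ∃ φ : ℕ → ℕ, StrictMono φ ∧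
      ∀ z, Tendsto (fun n => inner ℝ (x (φ n)) z) atTop (𝓝 (inner ℝ y z)) := by
  have hc := WeakDual.isSeqCompact_closedBall ℝ H 0 R
  let ψ : ℕ → WeakDual ℝ H := fun n => WeakDual.toStrongDual.symm (InnerProductSpace.toDual ℝ H (x n))
  have hψ : ∀ n, ψ n ∈ WeakDual.toStrongDual ⁻¹' Metric.closedBall (0 : StrongDual ℝ H) R := by
    intro n
    simp [ψ, hx n]
  obtain ⟨f, -, φ, hφ, hf⟩ := hc hψ
  refine ⟨(InnerProductSpace.toDual ℝ H).symm (WeakDual.toStrongDual f), φ, hφ, fun z => ?_⟩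
  have h1 := ((WeakDual.eval_continuous z).tendsto f).comp hf
  rw [InnerProductSpace.toDual_symm_apply]
  refine h1.congr fun n => ?_
  simp only [Function.comp, ψ]
  exact InnerProductSpace.toDual_apply_apply

lemma weak_lsc {H : Type*} [NormedAddCommGroup H] [InnerProductSpace ℝ H] {x : ℕ → H} {y : H} {k : ℝ}
    (hx : ∀ z, Tendsto (fun n => inner ℝ (x n) z) atTop (𝓝 (inner ℝ y z)))
    (hk : Tendsto (fun n => ‖x n‖ ^ 2) atTop (𝓝 k)) : ‖y‖ ^ 2 ≤ k := by
  have h1 := hx y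
  rw [real_inner_self_eq_norm_sq] at h1
  have h2 : Tendsto (fun n => ‖x n‖ ^ 2 - 2 * inner ℝ (x n) y + ‖y‖ ^ 2) atTop
      (𝓝 (k - 2 * ‖y‖ ^ 2 + ‖y‖^2)) := (hk.sub (h1.const_mul 2)).add_const _
  have h3 : 0 ≤ k - 2 * ‖y‖ ^ 2 + ‖y‖^2 := by
    refine ge_of_tendsto' h2 fun n => ?_
    rw [← norm_sub_sq_real]; positivity
  linarith

variable {α h Umin : ℝ} {U : E2 → ℝ} {q : E2}

lemma ii_one_sub_rpow {r : ℝ} (hr : -1 < r) :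
    IntervalIntegrable (fun t : ℝ => (1 - t) ^ r) volume 0 1 := by
  have h1 := (intervalIntegrable_rpow' (a := 1) (b := 0) hr).comp_sub_left 1
  simpa using h1

lemma hcA_nonempty (H : Hyp α h Umin U q) : ∃ u, HcA α h U q u := by
  obtain ⟨hα0, hα2⟩ := H.hα
  obtain ⟨γ, hγ1, hγ2⟩ : ∃ γ : ℝ, 1 / 2 < γ ∧ γ < 1 / α :=
    exists_between (one_div_lt_one_div_of_lt hα0 hα2)
  have hγ0 : 0 < γ := by linarith
  have hαγ : γ * α < 1 := by rwa [lt_div_iff₀ hα0] at hγ2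
  have iw0 : IntervalIntegrable (fun t : ℝ => (1 - t) ^ (γ - 1)) volume 0 1 :=
    ii_one_sub_rpow (by linarith)
  have iw : IntervalIntegrable (fun t : ℝ => (-(γ * (1 - t) ^ (γ - 1))) • q) volume 0 1 :=
    ((iw0.const_mul γ).neg).smul_continuousOn continuousOn_const
  have iw2 : IntervalIntegrable (fun t : ℝ => ‖(-(γ * (1 - t) ^ (γ - 1))) • q‖ ^ 2) volume 0 1 := by
    have h1 : IntervalIntegrable (fun t : ℝ => (γ ^ 2 * ‖q‖ ^ 2) * (1 - t) ^ (2 * γ - 2)) volume 0 1 :=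
      (ii_one_sub_rpow (by linarith)).const_mul _
    refine h1.congr fun t ht => ?_
    rw [uIoc_of_le zero_le_one] at ht
    rw [norm_smul, mul_pow, Real.norm_eq_abs, sq_abs, show 2 * γ - 2 = (γ - 1) * (2:ℕ) by push_cast; ring,
      Real.rpow_mul_natCast (by linarith [ht.2])]
    ring
  refine ⟨fun t => (1 - t) ^ γ • q, (hcA_of_rep iw iw2 ?_ ?_ ?_ ?_ ?_).1⟩
  · intro t ht
    rw [integral_eq_sub_of_hasDeriv_right (f := fun t : ℝ => (1 - t) ^ γ • q)]
    · simp
    · refine ContinuousOn.fun_smul ?_ continuousOn_const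
      exact (continuousOn_const.sub continuousOn_id).rpow_const fun _ _ => Or.inr hγ0.le
    · intro x hx
      rw [min_eq_left ht.1, max_eq_right ht.1] at hx
      have h1 : HasDerivAt (fun t : ℝ => (1 - t)) (-1) x := by
        simpa using (hasDerivAt_id x).const_sub 1
      have h2 := (h1.rpow_const (p := γ) (Or.inl (by linarith [hx.2, ht.2]))).smul_const q
      convert h2.hasDerivWithinAt using 1
      congr 1; ring
    · exact ii_sub iw (by simp) ht
  · simp [Real.zero_rpow hγ0.ne']
  · intro s hs
    rw [norm_smul, Real.norm_of_nonneg (Real.rpow_nonneg (by linarith [hs.2]) _)]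
    have := Real.rpow_le_one (by linarith [hs.2] : 0 ≤ 1 - s) (by linarith [hs.1]) hγ0.le
    nlinarith [norm_nonneg q]
  · have h₂ : ∀ᵐ x : ℝ, x ≠ 1 := by simp [ae_iff, measure_singleton]
    filter_upwards [h₂] with s hs1 hs
    refine smul_ne_zero ?_ H.hq
    have : 0 < 1 - s := by linarith [lt_of_le_of_ne hs.2 hs1]
    positivity
  · have h1 : IntervalIntegrable (fun t : ℝ => h + (1 - t) ^ (γ * (-α)) * Vpot α U q) volume 0 1 :=
      intervalIntegrable_const.add ((ii_one_sub_rpow (by linarith)).mul_const _)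
    have h₂ : ∀ᵐ x : ℝ, x ≠ 1 := by simp [ae_iff, measure_singleton]
    refine h1.congr_ae ((ae_restrict_iff' measurableSet_uIoc).2 ?_)
    filter_upwards [h₂] with s hs1 hs
    rw [uIoc_of_le zero_le_one] at hs
    have : 0 < 1 - s := by linarith [lt_of_le_of_ne hs.2 hs1]
    rw [vpot_hom (by positivity), Real.rpow_mul this.le]

end

section

variable {α h Umin : ℝ} {U : E2 → ℝ} {q : E2}

open scoped ENNReal in
/-- Extended potential. -/
noncomputable def gE (α h : ℝ) (U : E2 → ℝ) (x : E2) : ℝ≥0∞ :=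
  open Classical in if x = 0 then ⊤ else ENNReal.ofReal (h + Vpot α U x)

lemma gE_meas (hU : Continuous U) : Measurable (gE α h U) := by
  unfold gE
  refine Measurable.ite (measurableSet_eq_fun measurable_id measurable_const) measurable_const ?_
  exact ((vpot_meas hU).const_add h).ennreal_ofReal

lemma gE_lsc (H : Hyp α h Umin U q) {x : ℕ → E2} {y : E2} (hx : Tendsto x atTop (𝓝 y)) :
    gE α h U y ≤ liminf (fun n => gE α h U (x n)) atTop := by
  have hle : ∀ z, ENNReal.ofReal (h + Vpot α U z) ≤ gE α h U z := by
    intro z; unfold gE; split_ifs <;> simp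
  by_cases hy : y = 0
  · have h1 : Tendsto (fun n => gE α h U (x n)) atTop (𝓝 ⊤) := by
      rw [ENNReal.tendsto_nhds_top_iff_nnreal]
      intro c
      have h2 : Tendsto (fun r : ℝ => h + Umin * r ^ (-α)) (𝓝[>] 0) atTop := by
        apply tendsto_atTop_add_const_left
        apply Tendsto.const_mul_atTop H.hp
        exact tendsto_rpow_neg_nhdsGT_zero (by linarith [H.hα.1])
      have h3 := h2.eventually (eventually_gt_atTop (c:ℝ))
      rw [eventually_nhdsWithin_iff] at h3
      have h4 : Tendsto (fun n => ‖x n‖) atTop (𝓝 0) := by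
        have := hx.norm; rwa [hy, norm_zero] at this
      filter_upwards [h4.eventually h3] with n hn
      unfold gE
      split_ifs with h0
      · simp
      · have := hn (norm_pos_iff.2 h0)
        rw [← ENNReal.ofReal_coe_nnreal]
        have h5 := H.v_lb h0
        exact (ENNReal.ofReal_lt_ofReal_iff (lt_of_le_of_lt c.coe_nonneg (by linarith))).2 (by linarith)
    rw [h1.liminf_eq]; exact le_top
  · have h1 : Tendsto (fun n => ENNReal.ofReal (h + Vpot α U (x n))) atTop
        (𝓝 (ENNReal.ofReal (h + Vpot α U y))) := by
      refine (ENNReal.continuous_ofReal.tendsto _).comp ?_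
      exact ((vpot_cont H.hU hy).tendsto.comp hx).const_add h
    have h2 : gE α h U y = ENNReal.ofReal (h + Vpot α U y) := by simp [gE, hy]
    rw [h2, ← h1.liminf_eq]
    exact liminf_le_liminf (Eventually.of_forall fun n => hle _)

lemma lint_gE (H : Hyp α h Umin U q) {u : ℝ → E2} (A : HcA α h U q u) :
    ∫⁻ s in Ioc (0:ℝ) 1, gE α h U (u s) = ENNReal.ofReal (Pf α h U u) := by
  unfold Pf
  rw [intervalIntegral.integral_of_le zero_le_one, ofReal_integral_eq_lintegral_ofReal]
  · apply lintegral_congr_ae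
    refine (ae_restrict_iff' measurableSet_Ioc).2 ?_
    filter_upwards [A.nz] with s hs hs'
    simp [gE, hs (Ioc_subset_Icc_self hs')]
  · exact A.iP.1
  · refine (ae_restrict_iff' measurableSet_Ioc).2 ?_
    filter_upwards [A.ae_lb H] with s hs hs'
    exact H.δ_pos.le.trans (hs (Ioc_subset_Icc_self hs'))

noncomputable abbrev muI : Measure ℝ := volume.restrict (Ioc (0:ℝ) 1)

lemma HcA.memLp {u : ℝ → E2} (A : HcA α h U q u) : MemLp (deriv u) 2 muI := by
  rw [memLp_two_iff_integrable_sq_norm (stronglyMeasurable_deriv u).aestronglyMeasurable]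
  exact A.iK.1

lemma lp_norm_sq (f : Lp E2 2 muI) : ‖f‖ ^ 2 = ∫ s in (0:ℝ)..1, ‖f s‖ ^ 2 := by
  rw [← real_inner_self_eq_norm_sq, L2.inner_def, intervalIntegral.integral_of_le zero_le_one]
  simp only [real_inner_self_eq_norm_sq]

lemma HcA.norm_toLp {u : ℝ → E2} (A : HcA α h U q u) : ‖(A.memLp.toLp (deriv u) : Lp E2 2 muI)‖ ^ 2 = 2 * Kf u := by
  rw [lp_norm_sq, Kf]
  have : ∫ s in (0:ℝ)..1, ‖(A.memLp.toLp (deriv u) : Lp E2 2 muI) s‖ ^ 2 = ∫ s in (0:ℝ)..1, ‖deriv u s‖ ^ 2 := by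
    rw [intervalIntegral.integral_of_le zero_le_one, intervalIntegral.integral_of_le zero_le_one]
    apply MeasureTheory.integral_congr_ae
    filter_upwards [A.memLp.coeFn_toLp] with s hs
    rw [hs]
  rw [this]; ring

lemma lp_ii (f : Lp E2 2 muI) : IntervalIntegrable f volume 0 1 ∧
    IntervalIntegrable (fun s => ‖f s‖ ^ 2) volume 0 1 := by
  have h1 : MemLp f 2 muI := Lp.memLp f
  constructor
  · rw [intervalIntegrable_iff_integrableOn_Ioc_of_le zero_le_one]
    exact h1.integrable (by norm_num)
  · rw [intervalIntegrable_iff_integrableOn_Ioc_of_le zero_le_one]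
    exact (memLp_two_iff_integrable_sq_norm h1.1).1 h1

lemma lp_int (f : Lp E2 2 muI) (c : E2) {t : ℝ} (ht : t ∈ Icc (0:ℝ) 1) :
    inner ℝ f (indicatorConstLp 2 (measurableSet_Ioc (a := (0:ℝ)) (b := t))
      (measure_ne_top muI _) c) = inner ℝ c (∫ s in (0:ℝ)..t, f s) := by
  rw [real_inner_comm, L2.inner_indicatorConstLp_eq_inner_setIntegral,
    intervalIntegral.integral_of_le ht.1, Measure.restrict_restrict_of_subset]
  exact Ioc_subset_Ioc_right ht.2

lemma exists_min (H : Hyp α h Umin U q) : ∃ u, HcA α h U q u ∧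
    ∀ v, HcA α h U q v → Kf u * Pf α h U u ≤ Kf v * Pf α h U v := by
  let S : Set ℝ := {m | ∃ v, HcA α h U q v ∧ m = Kf v * Pf α h U v}
  have hS : S.Nonempty := by
    obtain ⟨v, hv⟩ := hcA_nonempty H
    exact ⟨_, v, hv, rfl⟩
  have hSb : BddBelow S := by
    refine ⟨0, ?_⟩
    rintro m ⟨v, hv, rfl⟩
    exact (mul_pos (hv.K_pos H) (hv.P_pos H)).le
  obtain ⟨x, -, hx, hxS⟩ := exists_seq_tendsto_sInf hS hSb
  choose v hv hxv using hxS
  obtain ⟨B, hB⟩ := hx.bddAbove_range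
  have hB' : ∀ n, Kf (v n) * Pf α h U (v n) ≤ B := fun n => by
    rw [← hxv n]; exact hB ⟨n, rfl⟩
  set d := h + Umin * ‖q‖ ^ (-α) with hd
  have hd0 : 0 < d := H.δ_pos
  have hq0 : 0 < ‖q‖ ^ 2 / 2 := by
    have := norm_pos_iff.2 H.hq
    positivity
  have hKb : ∀ n, Kf (v n) ∈ Icc 0 (B / d) := fun n => by
    refine ⟨((hv n).K_pos H).le, ?_⟩
    rw [le_div_iff₀ hd0]
    exact (mul_le_mul_of_nonneg_left ((hv n).P_lb H) ((hv n).K_pos H).le).trans (hB' n)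
  have hPb : ∀ n, Pf α h U (v n) ∈ Icc 0 (B / (‖q‖ ^ 2 / 2)) := fun n => by
    refine ⟨((hv n).P_pos H).le, ?_⟩
    rw [le_div_iff₀ hq0, mul_comm]
    exact (mul_le_mul_of_nonneg_right ((hv n).K_lb) ((hv n).P_pos H).le).trans (hB' n)
  obtain ⟨k, hk, φ1, hφ1, hk'⟩ := isCompact_Icc.tendsto_subseq hKb
  obtain ⟨p, hp, φ2, hφ2, hp'⟩ := isCompact_Icc.tendsto_subseq (fun n => hPb (φ1 n))
  have hWb : ∀ n, ‖((hv (φ1 (φ2 n))).memLp.toLp (deriv (v (φ1 (φ2 n)))) : Lp E2 2 muI)‖ ≤ Real.sqrt (2 * (B / d)) := fun n => by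
    apply Real.le_sqrt_of_sq_le
    rw [(hv (φ1 (φ2 n))).norm_toLp]
    linarith [(hKb (φ1 (φ2 n))).2]
  have : Fact ((2:ENNReal) ≠ ⊤) := ⟨by norm_num⟩
  have : SecondCountableTopology (Lp E2 2 muI) := Lp.SecondCountableTopology
  obtain ⟨y, φ3, hφ3, hy⟩ := weak_seq (fun n => ((hv (φ1 (φ2 n))).memLp.toLp (deriv (v (φ1 (φ2 n)))) : Lp E2 2 muI)) _ hWb
  set ψ : ℕ → ℕ := fun n => φ1 (φ2 (φ3 n)) with hψ
  have tK : Tendsto (fun n => Kf (v (ψ n))) atTop (𝓝 k) :=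
    (hk'.comp (hφ2.tendsto_atTop.comp hφ3.tendsto_atTop))
  have tP : Tendsto (fun n => Pf α h U (v (ψ n))) atTop (𝓝 p) := hp'.comp hφ3.tendsto_atTop
  have tM : Tendsto (fun n => Kf (v (ψ n)) * Pf α h U (v (ψ n))) atTop (𝓝 (sInf S)) := by
    have := hx.comp (hφ1.tendsto_atTop.comp (hφ2.tendsto_atTop.comp hφ3.tendsto_atTop))
    refine this.congr fun n => ?_
    simp [hxv, hψ]
  have hkp : k * p = sInf S := tendsto_nhds_unique (tK.mul tP) tM
  let u : ℝ → E2 := fun t => q + ∫ s in (0:ℝ)..t, y s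
  have hyn : ‖y‖ ^ 2 ≤ 2 * k := by
    refine weak_lsc hy ?_
    refine (tK.const_mul 2).congr fun n => ?_
    exact ((hv (ψ n)).norm_toLp).symm
  have hpt : ∀ t ∈ Icc (0:ℝ) 1, Tendsto (fun n => v (ψ n) t) atTop (𝓝 (u t)) := by
    intro t ht
    have h1 : ∀ c : E2, Tendsto (fun n => inner ℝ c (v (ψ n) t)) atTop (𝓝 (inner ℝ c (u t))) := by
      intro c
      have h2 := (hy (indicatorConstLp 2 (measurableSet_Ioc (a := (0:ℝ)) (b := t))
        (measure_ne_top muI _) c)).const_add (inner ℝ c q)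
      rw [lp_int _ _ ht] at h2
      simp only [u, inner_add_right]
      refine h2.congr fun n => ?_
      rw [lp_int _ _ ht, ← inner_add_right]
      congr 1
      have h3 : ∫ s in (0:ℝ)..t, ((hv (ψ n)).memLp.toLp (deriv (v (ψ n))) : Lp E2 2 muI) s = ∫ s in (0:ℝ)..t, deriv (v (ψ n)) s := by
        rw [intervalIntegral.integral_of_le ht.1, intervalIntegral.integral_of_le ht.1]
        apply MeasureTheory.integral_congr_ae
        exact ae_restrict_of_ae_restrict_of_subset (Ioc_subset_Ioc_right ht.2)
          (hv (ψ n)).memLp.coeFn_toLp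
      have h4 := (hv (ψ n)).ftc (by simp : (0:ℝ) ∈ Icc (0:ℝ) 1) ht
      rw [(hv (ψ n)).u0] at h4
      rw [h3, h4]; abel
    have h5 : Tendsto (fun n => (WithLp.ofLp (v (ψ n) t))) atTop (𝓝 (WithLp.ofLp (u t))) := by
      rw [tendsto_pi_nhds]
      intro i
      have := h1 (EuclideanSpace.single i 1)
      simpa [EuclideanSpace.inner_single_left] using this
    have h6 := ((PiLp.continuous_toLp 2 (fun _ : Fin 2 => ℝ)).tendsto _).comp h5
    exact h6
  have hu1 : u 1 = 0 := by
    refine tendsto_nhds_unique (hpt 1 (by simp)) ?_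
    simp only [fun n => (hv (ψ n)).u1]
    exact tendsto_const_nhds
  have hub : ∀ s ∈ Icc (0:ℝ) 1, ‖u s‖ ≤ ‖q‖ := fun s hs =>
    le_of_tendsto' (hpt s hs).norm fun n => (hv (ψ n)).bd s hs
  obtain ⟨iy, iy2⟩ := lp_ii y
  obtain ⟨uac, -⟩ := ac_of_rep (u := u) iy (fun t _ => rfl)
  have ucont : ContinuousOn u (Icc 0 1) := by simpa [uIcc_of_le] using uac.continuousOn
  have umeas : AEMeasurable u muI :=
    (ucont.mono Ioc_subset_Icc_self).aemeasurable measurableSet_Ioc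
  have hfat : ∫⁻ s in Ioc (0:ℝ) 1, gE α h U (u s) ≤ ENNReal.ofReal p := by
    have h1 : ∫⁻ s in Ioc (0:ℝ) 1, gE α h U (u s) ≤
        ∫⁻ s in Ioc (0:ℝ) 1, liminf (fun n => gE α h U (v (ψ n) s)) atTop := by
      apply setLIntegral_mono' measurableSet_Ioc
      intro s hs
      exact gE_lsc H (hpt s (Ioc_subset_Icc_self hs))
    refine h1.trans ((lintegral_liminf_le' fun n => ?_).trans ?_)
    · exact (gE_meas H.hU).comp_aemeasurable
        (((hv (ψ n)).cont.mono Ioc_subset_Icc_self).aemeasurable measurableSet_Ioc)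
    · simp only [fun n => lint_gE H (hv (ψ n))]
      exact ((ENNReal.continuous_ofReal.tendsto p).comp tP).liminf_eq.le
  have hfin : ∀ᵐ s ∂muI, gE α h U (u s) < ⊤ :=
    ae_lt_top' ((gE_meas H.hU).comp_aemeasurable umeas) (hfat.trans_lt ENNReal.ofReal_lt_top).ne
  have hunz : ∀ᵐ s, s ∈ Icc (0:ℝ) 1 → u s ≠ 0 := by
    have h₁ : ∀ᵐ x : ℝ, x ≠ 0 := by simp [ae_iff, measure_singleton]
    filter_upwards [h₁, (ae_restrict_iff' measurableSet_Ioc).1 hfin] with s hs0 hs hs' h0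
    have := hs ⟨lt_of_le_of_ne hs'.1 (Ne.symm hs0), hs'.2⟩
    simp [gE, h0] at this
  have hnn : ∀ᵐ s ∂muI, 0 ≤ h + Vpot α U (u s) := by
    refine (ae_restrict_iff' measurableSet_Ioc).2 ?_
    filter_upwards [hunz] with s hs hs'
    exact H.δ_pos.le.trans (H.δ_le (hs (Ioc_subset_Icc_self hs')) (hub s (Ioc_subset_Icc_self hs')))
  have hVm : AEStronglyMeasurable (fun s => h + Vpot α U (u s)) muI :=
    (((vpot_meas H.hU).comp_aemeasurable umeas).const_add h).aestronglyMeasurable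
  have hlint : ∫⁻ s in Ioc (0:ℝ) 1, ENNReal.ofReal (h + Vpot α U (u s)) ≤ ENNReal.ofReal p := by
    refine le_trans (lintegral_mono fun s => ?_) hfat
    simp only [gE]; split_ifs <;> simp
  have uiP : IntervalIntegrable (fun s => h + Vpot α U (u s)) volume 0 1 := by
    rw [intervalIntegrable_iff_integrableOn_Ioc_of_le zero_le_one]
    refine ⟨hVm, ?_⟩
    rw [hasFiniteIntegral_iff_ofReal hnn]
    exact hlint.trans_lt ENNReal.ofReal_lt_top
  obtain ⟨hA, hK⟩ := hcA_of_rep (u := u) iy iy2 (fun t _ => rfl) hu1 hub hunz uiP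
  refine ⟨u, hA, fun w hw => ?_⟩
  have hKu : Kf u ≤ k := by
    rw [Kf, hK, ← lp_norm_sq]; linarith
  have hPu : Pf α h U u ≤ p := by
    rw [Pf, intervalIntegral.integral_of_le zero_le_one, integral_eq_lintegral_of_nonneg_ae hnn hVm]
    exact ENNReal.toReal_le_of_le_ofReal hp.1 hlint
  calc Kf u * Pf α h U u ≤ k * p := mul_le_mul hKu hPu (hA.P_pos H).le hk.1
    _ = sInf S := hkp
    _ ≤ _ := csInf_le hSb ⟨w, hw, rfl⟩

end

section

lemma ite_ii {F : Type*} [NormedAddCommGroup F] [NormedSpace ℝ F] {f g : ℝ → F} {b : ℝ}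
    (hb : b ∈ Icc (0:ℝ) 1) (hf : IntervalIntegrable f volume 0 b)
    (hg : IntervalIntegrable g volume b 1) :
    IntervalIntegrable (fun t => if t ≤ b then f t else g t) volume 0 1 ∧
    (∀ t ∈ Icc 0 b, ∫ s in (0:ℝ)..t, (if s ≤ b then f s else g s) = ∫ s in (0:ℝ)..t, f s) ∧
    (∀ t ∈ Icc b 1, ∫ s in (0:ℝ)..t, (if s ≤ b then f s else g s) =
      (∫ s in (0:ℝ)..b, f s) + ∫ s in b..t, g s) := by
  have h1 : IntervalIntegrable (fun t => if t ≤ b then f t else g t) volume 0 b := by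
    refine hf.congr fun t ht => ?_
    rw [uIoc_of_le hb.1] at ht
    simp [ht.2]
  have h2 : IntervalIntegrable (fun t => if t ≤ b then f t else g t) volume b 1 := by
    refine hg.congr fun t ht => ?_
    rw [uIoc_of_le hb.2] at ht
    simp [not_le.2 ht.1]
  have h3 : ∀ t ∈ Icc 0 b, ∫ s in (0:ℝ)..t, (if s ≤ b then f s else g s) = ∫ s in (0:ℝ)..t, f s := by
    intro t ht
    apply intervalIntegral.integral_congr_ae
    refine Eventually.of_forall fun s hs => ?_
    rw [uIoc_of_le ht.1] at hs
    simp [hs.2.trans ht.2]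
  refine ⟨h1.trans h2, h3, fun t ht => ?_⟩
  have ht1 : b ∈ uIcc b t := left_mem_uIcc
  rw [← integral_add_adjacent_intervals h1 (h2.mono_set (uIcc_subset_uIcc_left
    (by rw [uIcc_of_le hb.2]; exact ht))), h3 b ⟨hb.1, le_rfl⟩]
  congr 1
  apply intervalIntegral.integral_congr_ae
  refine Eventually.of_forall fun s hs => ?_
  rw [uIoc_of_le ht.1] at hs
  simp [not_le.2 hs.1]

lemma aff_ii {F : Type*} [NormedAddCommGroup F] {g : ℝ → F} {x d s t : ℝ}
    (hx : x ≠ 0) (hg : IntervalIntegrable g volume (x * s + d) (x * t + d)) :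
    IntervalIntegrable (fun r => g (x * r + d)) volume s t := by
  have h1 := (hg.comp_add_right d).comp_mul_left (c := x)
  simpa [mul_div_cancel_left₀ _ hx] using h1

lemma aff_ae {N : ℝ → Prop} (hN : ∀ᵐ s, N s) {x : ℝ} (hx : x ≠ 0) (d : ℝ) :
    ∀ᵐ s, N (x * s + d) := by
  rw [ae_iff] at hN ⊢
  have : {s | ¬ N (x * s + d)} = (x * ·) ⁻¹' ((· + d) ⁻¹' {s | ¬ N s}) := rfl
  rw [this, Real.volume_preimage_mul_left hx, measure_preimage_add_right, hN, mul_zero]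

lemma two_eq {p r : ℝ} (hp : 0 ≤ p) (hr : 0 ≤ r) (hz : ∀ z > 0, p + r ≤ z * p + z⁻¹ * r) : p = r := by
  rcases hr.eq_or_lt with rfl | hr
  · have := hz (1/2) (by norm_num)
    linarith
  · have hs : 0 < r + p := by linarith
    have h1 := hz (2 * r / (r + p)) (by positivity)
    have h2 : 2 * r / (r + p) * p + (2 * r / (r + p))⁻¹ * r = 2 * r * p / (r + p) + (r + p) / 2 := by
      field_simp
    rw [h2] at h1
    have h3 : (r + p) / 2 ≤ 2 * r * p / (r + p) := by linarith
    rw [le_div_iff₀ hs] at h3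
    nlinarith [sq_nonneg (r - p)]

variable {α h Umin : ℝ} {U : E2 → ℝ} {q : E2}

/-- minimiser of the relaxed problem -/
structure IsMinA (α h : ℝ) (U : E2 → ℝ) (q : E2) (u : ℝ → E2) : Prop where
  A : HcA α h U q u
  min : ∀ v, HcA α h U q v → Kf u * Pf α h U u ≤ Kf v * Pf α h U v

namespace IsMinA

variable {u : ℝ → E2}

lemma c_pos (H : Hyp α h Umin U q) (M : IsMinA α h U q u) : 0 < Kf u / Pf α h U u :=
  div_pos (M.A.K_pos H) (M.A.P_pos H)

lemma add_min (H : Hyp α h Umin U q) (M : IsMinA α h U q u) {v : ℝ → E2} (hv : HcA α h U q v) :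
    Kf u + Kf u / Pf α h U u * Pf α h U u ≤ Kf v + Kf u / Pf α h U u * Pf α h U v := by
  have hK := M.A.K_pos H
  have hP := M.A.P_pos H
  have hK' := hv.K_pos H
  have hP' := hv.P_pos H
  have hm := M.min v hv
  have hc := M.c_pos H
  set c := Kf u / Pf α h U u with hcd
  have e : c * Pf α h U u = Kf u := by rw [hcd]; field_simp
  have h1 : Kf u * Kf u ≤ Kf v * (c * Pf α h U v) := by
    nlinarith
  have : 0 < c * Pf α h U v := mul_pos hc hP'
  rw [e]
  nlinarith [sq_nonneg (Kf v - c * Pf α h U v)]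

lemma energy_int (H : Hyp α h Umin U q) (M : IsMinA α h U q u) {a : ℝ} (ha : a ∈ Ioo (0:ℝ) 1) :
    (1/2) * ∫ s in (0:ℝ)..a, ‖deriv u s‖ ^ 2 =
      Kf u / Pf α h U u * ∫ s in (0:ℝ)..a, (h + Vpot α U (u s)) := by
  have A := M.A
  have m0 : (0:ℝ) ∈ Icc (0:ℝ) 1 := by simp
  have m1 : (1:ℝ) ∈ Icc (0:ℝ) 1 := by simp
  have ma : a ∈ Icc (0:ℝ) 1 := Ioo_subset_Icc_self ha
  set KA := (1/2) * ∫ s in (0:ℝ)..a, ‖deriv u s‖ ^ 2 with hKA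
  set KB := (1/2) * ∫ s in a..1, ‖deriv u s‖ ^ 2 with hKB
  set PA := ∫ s in (0:ℝ)..a, (h + Vpot α U (u s)) with hPA
  set PB := ∫ s in a..1, (h + Vpot α U (u s)) with hPB
  have eK : Kf u = KA + KB := by
    rw [Kf, hKA, hKB, ← mul_add, integral_add_adjacent_intervals (ii_sub A.iK m0 ma) (ii_sub A.iK ma m1)]
  have eP : Pf α h U u = PA + PB := by
    rw [Pf, hPA, hPB, integral_add_adjacent_intervals (ii_sub A.iP m0 ma) (ii_sub A.iP ma m1)]
  have hnn : ∀ s t, 0 ≤ s → s ≤ t → t ≤ 1 → 0 ≤ ∫ x in s..t, (h + Vpot α U (u x)) := by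
    intro s t hs hst ht
    apply intervalIntegral.integral_nonneg_of_ae_restrict hst
    refine (ae_restrict_iff' measurableSet_Icc).2 ?_
    filter_upwards [A.ae_lb H] with x hx hx'
    exact H.δ_pos.le.trans (hx ⟨hs.trans hx'.1, hx'.2.trans ht⟩)
  have hPA0 : 0 ≤ PA := hnn _ _ le_rfl ha.1.le ha.2.le
  have hPB0 : 0 ≤ PB := hnn _ _ ha.1.le ha.2.le le_rfl
  have hKA0 : 0 ≤ KA := by
    have : 0 ≤ ∫ s in (0:ℝ)..a, ‖deriv u s‖ ^ 2 :=
      intervalIntegral.integral_nonneg ha.1.le fun s _ => by positivity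
    linarith
  have hKB0 : 0 ≤ KB := by
    have : 0 ≤ ∫ s in a..1, ‖deriv u s‖ ^ 2 :=
      intervalIntegral.integral_nonneg ha.2.le fun s _ => by positivity
    linarith
  have key : KA * PB = KB * PA := by
    refine two_eq (mul_nonneg hKA0 hPB0) (mul_nonneg hKB0 hPA0) fun z hz => ?_
    have h1a : 0 < 1 - a := by linarith [ha.2]
    have ha0 := ha.1
    set x := a + z * (1 - a) with hx
    have hx0 : 0 < x := by positivity
    set b := a / x with hb
    set y := x / z with hy
    have hy0 : 0 < y := by positivity
    have hb0 : 0 < b := by positivity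
    have hb1 : b < 1 := by
      rw [hb, div_lt_one hx0]
      have : 0 < z * (1 - a) := by positivity
      linarith
    have e1 : x * b = a := by rw [hb]; field_simp
    have e2 : y * (1 - b) = 1 - a := by
      have : x * (1 - b) = z * (1 - a) := by rw [mul_sub, e1, hx]; ring
      rw [hy, div_mul_eq_mul_div, this]; field_simp
    set d := a - y * b with hd
    have hbm : b ∈ Icc (0:ℝ) 1 := ⟨hb0.le, hb1.le⟩
    have f1 : ∀ t ∈ Icc 0 b, x * t + 0 ∈ Icc (0:ℝ) 1 := by
      intro t ht
      have := mul_le_mul_of_nonneg_left ht.2 hx0.le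
      have := mul_nonneg hx0.le ht.1
      constructor <;> linarith
    have f2 : ∀ t ∈ Icc b 1, y * t + d ∈ Icc (0:ℝ) 1 := by
      intro t ht
      have := mul_le_mul_of_nonneg_left ht.2 hy0.le
      have := mul_le_mul_of_nonneg_left ht.1 hy0.le
      constructor <;> nlinarith
    have e0 : x * 0 + 0 = 0 := by ring
    have e1' : x * b + 0 = a := by linarith
    have eb : y * b + d = a := by rw [hd]; ring
    have e2' : y * 1 + d = 1 := by rw [hd]; linarith
    let v : ℝ → E2 := fun t => if t ≤ b then u (x * t + 0) else u (y * t + d)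
    let w : ℝ → E2 := fun t => if t ≤ b then x • deriv u (x * t + 0) else y • deriv u (y * t + d)
    have i1 : IntervalIntegrable (fun t => deriv u (x * t + 0)) volume 0 b :=
      aff_ii hx0.ne' (by rw [e0, e1']; exact ii_sub A.iw m0 ma)
    have i2 : IntervalIntegrable (fun t => deriv u (y * t + d)) volume b 1 :=
      aff_ii hy0.ne' (by rw [eb, e2']; exact ii_sub A.iw ma m1)
    have j1 : IntervalIntegrable (fun t => ‖deriv u (x * t + 0)‖ ^ 2) volume 0 b :=
      aff_ii (g := fun s => ‖deriv u s‖ ^ 2) hx0.ne' (by rw [e0, e1']; exact ii_sub A.iK m0 ma)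
    have j2 : IntervalIntegrable (fun t => ‖deriv u (y * t + d)‖ ^ 2) volume b 1 :=
      aff_ii (g := fun s => ‖deriv u s‖ ^ 2) hy0.ne' (by rw [eb, e2']; exact ii_sub A.iK ma m1)
    have k1 : IntervalIntegrable (fun t => h + Vpot α U (u (x * t + 0))) volume 0 b :=
      aff_ii (g := fun s => h + Vpot α U (u s)) hx0.ne' (by rw [e0, e1']; exact ii_sub A.iP m0 ma)
    have k2 : IntervalIntegrable (fun t => h + Vpot α U (u (y * t + d))) volume b 1 :=
      aff_ii (g := fun s => h + Vpot α U (u s)) hy0.ne' (by rw [eb, e2']; exact ii_sub A.iP ma m1)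
    obtain ⟨w1, w2, w3⟩ := ite_ii hbm (i1.smul x) (i2.smul y)
    obtain ⟨s1, -, s3⟩ := ite_ii hbm (j1.const_mul (x ^ 2)) (j2.const_mul (y ^ 2))
    obtain ⟨p1, -, p3⟩ := ite_ii hbm k1 k2
    have ew : (fun t => ‖w t‖ ^ 2) = fun t => if t ≤ b then x ^ 2 * ‖deriv u (x * t + 0)‖ ^ 2 else
        y ^ 2 * ‖deriv u (y * t + d)‖ ^ 2 := by
      funext t
      simp only [w]
      split_ifs
      · rw [norm_smul, Real.norm_of_nonneg hx0.le, mul_pow]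
      · rw [norm_smul, Real.norm_of_nonneg hy0.le, mul_pow]
    have ep : (fun t => h + Vpot α U (v t)) = fun t => if t ≤ b then h + Vpot α U (u (x * t + 0)) else
        h + Vpot α U (u (y * t + d)) := by
      funext t
      simp only [v]
      split_ifs <;> rfl
    have hmem : ∀ t ∈ Icc (0:ℝ) 1, (t ≤ b → x * t + 0 ∈ Icc (0:ℝ) 1) ∧
        (¬ t ≤ b → y * t + d ∈ Icc (0:ℝ) 1) := fun t ht =>
      ⟨fun h => f1 t ⟨ht.1, h⟩, fun h => f2 t ⟨(not_le.1 h).le, ht.2⟩⟩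
    have rep : ∀ t ∈ Icc (0:ℝ) 1, v t = q + ∫ s in (0:ℝ)..t, w s := by
      intro t ht
      by_cases htb : t ≤ b
      · have := w2 t ⟨ht.1, htb⟩
        simp only [w]
        rw [Pi.smul_def, Pi.smul_def] at this
        rw [this, intervalIntegral.integral_smul, smul_integral_comp_mul_add, e0,
          A.ftc m0 ((hmem t ht).1 htb), A.u0]
        simp [v, htb]
      · have htb' := (not_le.1 htb).le
        have := w3 t ⟨htb', ht.2⟩
        simp only [w]
        rw [Pi.smul_def, Pi.smul_def] at this
        rw [this, intervalIntegral.integral_smul, smul_integral_comp_mul_add, e0,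
          intervalIntegral.integral_smul, smul_integral_comp_mul_add, eb, e1',
          A.ftc m0 ma, A.ftc ma ((hmem t ht).2 htb), A.u0]
        simp [v, htb]
    obtain ⟨hA, hK⟩ := hcA_of_rep (α := α) (h := h) (U := U) (q := q) (u := v) (w := w)
      w1 (by rw [ew]; exact s1) rep
      (by simp only [v]; rw [if_neg (not_le.2 hb1), e2', A.u1])
      (by
        intro t ht
        simp only [v]
        split_ifs with hc
        · exact A.bd _ ((hmem t ht).1 hc)
        · exact A.bd _ ((hmem t ht).2 hc))
      (by
        filter_upwards [aff_ae A.nz hx0.ne' 0, aff_ae A.nz hy0.ne' d] with t h1 h2 ht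
        simp only [v]
        split_ifs with hc
        · exact h1 ((hmem t ht).1 hc)
        · exact h2 ((hmem t ht).2 hc))
      (by rw [ep]; exact p1)
    have hKv : Kf v = x * KA + y * KB := by
      rw [Kf, hK, ew, s3 1 ⟨hb1.le, le_rfl⟩, intervalIntegral.integral_const_mul,
        intervalIntegral.integral_const_mul]
      have q1 := smul_integral_comp_mul_add (a := 0) (b := b) (fun s => ‖deriv u s‖ ^ 2) x 0
      have q2 := smul_integral_comp_mul_add (a := b) (b := 1) (fun s => ‖deriv u s‖ ^ 2) y d
      rw [e0, e1', smul_eq_mul] at q1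
      rw [eb, e2', smul_eq_mul] at q2
      rw [hKA, hKB, ← q1, ← q2]; ring
    have hPv : Pf α h U v = x⁻¹ * PA + y⁻¹ * PB := by
      rw [Pf, ep, p3 1 ⟨hb1.le, le_rfl⟩]
      have q1 := smul_integral_comp_mul_add (a := 0) (b := b) (fun s => h + Vpot α U (u s)) x 0
      have q2 := smul_integral_comp_mul_add (a := b) (b := 1) (fun s => h + Vpot α U (u s)) y d
      rw [e0, e1', smul_eq_mul] at q1
      rw [eb, e2', smul_eq_mul] at q2
      rw [hPA, hPB, ← q1, ← q2, inv_mul_cancel_left₀ hx0.ne', inv_mul_cancel_left₀ hy0.ne']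
    have hm := M.min v hA
    rw [hKv, hPv, eK, eP] at hm
    have e3 : (x * KA + y * KB) * (x⁻¹ * PA + y⁻¹ * PB) =
        KA * PA + KB * PB + (z * (KA * PB) + z⁻¹ * (KB * PA)) := by
      rw [hy]; field_simp; ring
    rw [e3] at hm
    linarith
  have hP := M.A.P_pos H
  rw [eK, eP]
  rw [eP] at hP
  field_simp
  linarith

lemma energy_int' (H : Hyp α h Umin U q) (M : IsMinA α h U q u) {a : ℝ} (ha : a ∈ Icc (0:ℝ) 1) :
    (1/2) * ∫ s in (0:ℝ)..a, ‖deriv u s‖ ^ 2 =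
      Kf u / Pf α h U u * ∫ s in (0:ℝ)..a, (h + Vpot α U (u s)) := by
  rcases ha.1.eq_or_lt with rfl | h0
  · simp
  rcases ha.2.eq_or_lt with rfl | h1
  · have hP := M.A.P_pos H
    change Kf u = Kf u / Pf α h U u * Pf α h U u
    field_simp
  · exact M.energy_int H ⟨h0, h1⟩

lemma energy_sub (H : Hyp α h Umin U q) (M : IsMinA α h U q u) {a b : ℝ} (ha : a ∈ Icc (0:ℝ) 1)
    (hb : b ∈ Icc (0:ℝ) 1) :
    (1/2) * ∫ s in a..b, ‖deriv u s‖ ^ 2 =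
      Kf u / Pf α h U u * ∫ s in a..b, (h + Vpot α U (u s)) := by
  have m0 : (0:ℝ) ∈ Icc (0:ℝ) 1 := by simp
  have h1 := M.energy_int' H ha
  have h2 := M.energy_int' H hb
  rw [← integral_add_adjacent_intervals (ii_sub M.A.iK m0 ha) (ii_sub M.A.iK ha hb),
    ← integral_add_adjacent_intervals (ii_sub M.A.iP m0 ha) (ii_sub M.A.iP ha hb)] at h2
  linarith

lemma energy_ae (H : Hyp α h Umin U q) (M : IsMinA α h U q u) :
    ∀ᵐ t, t ∈ Icc (0:ℝ) 1 → ‖deriv u t‖ ^ 2 =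
      2 * (Kf u / Pf α h U u) * (h + Vpot α U (u t)) := by
  have g0 : ∀ᵐ x : ℝ, x ≠ 0 := by simp [ae_iff, measure_singleton]
  have g1 : ∀ᵐ x : ℝ, x ≠ 1 := by simp [ae_iff, measure_singleton]
  filter_upwards [g0, g1, M.A.iK.ae_hasDerivAt_integral, M.A.iP.ae_hasDerivAt_integral]
    with t t0 t1 h1 h2 ht
  rw [uIcc_of_le zero_le_one] at h1 h2
  have d1 := (h1 ht 0 (by simp)).const_mul (1/2)
  have d2 := (h2 ht 0 (by simp)).const_mul (Kf u / Pf α h U u)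
  have hio : t ∈ Ioo (0:ℝ) 1 := ⟨lt_of_le_of_ne ht.1 (Ne.symm t0), lt_of_le_of_ne ht.2 t1⟩
  have d3 := d2.congr_of_eventuallyEq (f₁ := fun t => (1/2) * ∫ s in (0:ℝ)..t, ‖deriv u s‖ ^ 2)
    (by
      filter_upwards [isOpen_Ioo.mem_nhds hio] with s hs
      exact M.energy_int H hs)
  have := d1.unique d3
  linarith

end IsMinA

end

lemma rpow_taylor {α x : ℝ} (hα : α ∈ Ioo (0:ℝ) 2) (hx0 : 0 ≤ x) (hx : x ≤ 1/4) :
    (1 - x) ^ (-α) ≤ 1 + α * x + 13 * x ^ 2 := by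
  have hy : 0 < 1 - x := by linarith
  rw [Real.rpow_def_of_pos hy]
  have h1 := Real.one_sub_inv_le_log_of_pos hy
  have h2 : (1 - x)⁻¹ ≤ 1 + x + 2 * x ^ 2 := by
    rw [inv_le_iff_one_le_mul₀ hy]
    nlinarith [mul_nonneg hx0 hx0, mul_nonneg (mul_nonneg hx0 hx0) (by linarith : 0 ≤ 1/4 - x)]
  have h3 : Real.log (1 - x) * (-α) ≤ α * (x + 2 * x ^ 2) := by
    nlinarith [hα.1]
  set s := α * (x + 2 * x ^ 2) with hs
  have hs0 : 0 ≤ s := by have := hα.1; positivity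
  have hx2 : x ^ 2 ≤ x / 4 := by nlinarith
  have hs1 : s ≤ 2 * (x + 2 * x ^ 2) :=
    mul_le_mul_of_nonneg_right hα.2.le (by positivity)
  have hs3 : s ≤ 3 * x := by linarith
  have h4 := Real.abs_exp_sub_one_sub_id_le (x := s) (by rw [abs_of_nonneg hs0]; linarith)
  have h5 := (abs_le.1 h4).2
  have h6 := Real.exp_le_exp.2 h3
  have h7 : s ^ 2 ≤ 9 * x ^ 2 := by nlinarith
  have h8 : s ≤ α * x + 4 * x ^ 2 := by
    rw [hs]; nlinarith [hα.2, sq_nonneg x]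
  linarith

lemma eps_lin {A R : ℝ} (h : ∀ ε, 0 < ε → ε ≤ 1/4 → 0 ≤ ε * A + ε ^ 2 * R) : 0 ≤ A := by
  have h1 : ∀ᶠ ε in 𝓝[>] (0:ℝ), 0 ≤ A + ε * R := by
    filter_upwards [Ioc_mem_nhdsGT (show (0:ℝ) < 1/4 by norm_num)] with ε hε
    have := h ε hε.1 hε.2
    have h2 : 0 ≤ ε * (A + ε * R) := by linarith [this, show ε * (A + ε * R) = ε * A + ε ^ 2 * R by ring]
    exact nonneg_of_mul_nonneg_right h2 hε.1
  have h2 : Tendsto (fun ε : ℝ => A + ε * R) (𝓝[>] 0) (𝓝 (A + 0 * R)) := by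
    have : Continuous fun ε : ℝ => A + ε * R := by fun_prop
    exact (this.tendsto 0).mono_left nhdsWithin_le_nhds
  have := ge_of_tendsto h2 h1
  simpa using this

namespace IsMinA

variable {α h Umin : ℝ} {U : E2 → ℝ} {q : E2} {u : ℝ → E2}

lemma ii_eta_inner (M : IsMinA α h U q u) {η : ℝ → ℝ} {C : NNReal} (hη : LipschitzWith C η) :
    IntervalIntegrable (fun t => deriv η t * inner ℝ (deriv u t) (u t)) volume 0 1 := by
  have A := M.A
  have hum : AEStronglyMeasurable u (volume.restrict (uIoc 0 1)) := by
    rw [uIoc_of_le zero_le_one]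
    exact (A.cont.mono Ioc_subset_Icc_self).aestronglyMeasurable measurableSet_Ioc
  have g1 : IntervalIntegrable (fun t => (C:ℝ) * ‖q‖ * ‖deriv u t‖) volume 0 1 :=
    A.iw.norm.const_mul _
  refine g1.mono_fun ?_ ?_
  · refine AEStronglyMeasurable.mul ?_ ?_
    · exact (stronglyMeasurable_deriv η).aestronglyMeasurable
    · exact (stronglyMeasurable_deriv u).aestronglyMeasurable.inner hum
  · refine (ae_restrict_iff' measurableSet_uIoc).2 (Eventually.of_forall fun t ht => ?_)
    rw [uIoc_of_le zero_le_one] at ht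
    have b1 := A.bd t (Ioc_subset_Icc_self ht)
    have b2 : ‖deriv η t‖ ≤ C := norm_deriv_le_of_lipschitz hη
    have b3 := norm_inner_le_norm (𝕜 := ℝ) (deriv u t) (u t)
    beta_reduce
    rw [norm_mul, Real.norm_of_nonneg (by positivity : 0 ≤ (C:ℝ) * ‖q‖ * ‖deriv u t‖)]
    calc _ ≤ (C:ℝ) * (‖deriv u t‖ * ‖q‖) := by gcongr; exact b3.trans (by gcongr)
      _ = _ := by ring

lemma first_var (H : Hyp α h Umin U q) (M : IsMinA α h U q u) {η : ℝ → ℝ} {C : NNReal}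
    (hη : LipschitzWith C η) (h0 : ∀ t, 0 ≤ η t) (h1 : ∀ t, η t ≤ 1) (hη0 : η 0 = 0) :
    ∫ t in (0:ℝ)..1, deriv η t * inner ℝ (deriv u t) (u t) ≤ 0 := by
  have A := M.A
  have hc := M.c_pos H
  set c := Kf u / Pf α h U u with hcd
  have iJ := M.ii_eta_inner hη
  have hηac : AbsolutelyContinuousOnInterval η 0 1 :=
    (hη.lipschitzOnWith (s := uIcc 0 1)).absolutelyContinuousOnInterval
  have hηd : ∀ᵐ t, t ∈ Icc (0:ℝ) 1 → HasDerivAt η (deriv η t) t := by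
    filter_upwards [hηac.ae_differentiableAt] with t ht ht'
    exact (ht (by rwa [uIcc_of_le zero_le_one])).hasDerivAt
  have iηK : IntervalIntegrable (fun t => η t * ‖deriv u t‖ ^ 2) volume 0 1 :=
    A.iK.continuousOn_mul hη.continuous.continuousOn
  have iηV : IntervalIntegrable (fun t => η t * Vpot α U (u t)) volume 0 1 :=
    A.iV.continuousOn_mul hη.continuous.continuousOn
  have iη : IntervalIntegrable η volume 0 1 := hη.continuous.intervalIntegrable _ _
  let X : ℝ → ℝ := fun t => η t * ‖deriv u t‖ ^ 2 + deriv η t * inner ℝ (deriv u t) (u t)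
  have iX : IntervalIntegrable X volume 0 1 := iηK.add iJ
  let G : ℝ → ℝ := fun t => 2 * ‖deriv u t‖ ^ 2 + 2 * ((C:ℝ) * ‖q‖) ^ 2
  have iG : IntervalIntegrable G volume 0 1 := (A.iK.const_mul 2).add intervalIntegrable_const
  have hum : AEStronglyMeasurable u (volume.restrict (uIoc 0 1)) := by
    rw [uIoc_of_le zero_le_one]
    exact (A.cont.mono Ioc_subset_Icc_self).aestronglyMeasurable measurableSet_Ioc
  have hvar : ∫ t in (0:ℝ)..1, X t ≤ c * (α * ∫ t in (0:ℝ)..1, η t * Vpot α U (u t)) := by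
    suffices hs : 0 ≤ c * (α * ∫ t in (0:ℝ)..1, η t * Vpot α U (u t)) - ∫ t in (0:ℝ)..1, X t by
      linarith
    refine eps_lin (R := (1/2) * (∫ t in (0:ℝ)..1, G t) +
      c * (13 * ∫ t in (0:ℝ)..1, Vpot α U (u t))) fun ε hε hε4 => ?_
    have p0 : ∀ t, 0 ≤ ε * η t := fun t => mul_nonneg hε.le (h0 t)
    have p1 : ∀ t, ε * η t ≤ 1/4 := fun t => by
      have := mul_le_mul_of_nonneg_left (h1 t) hε.le
      linarith
    have p2 : ∀ t, (ε * η t) ^ 2 ≤ ε ^ 2 := fun t => by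
      have := mul_le_mul_of_nonneg_left (h1 t) hε.le
      exact pow_le_pow_left₀ (p0 t) (by linarith) 2
    let ρ : ℝ → ℝ := fun t => 1 - ε * η t
    have ρ0 : ∀ t, 0 < ρ t := fun t => by have := p1 t; simp only [ρ]; linarith
    have ρ1 : ∀ t, ρ t ≤ 1 := fun t => by have := p0 t; simp only [ρ]; linarith
    have ρc : Continuous ρ := by have := hη.continuous; fun_prop
    let v : ℝ → E2 := fun t => ρ t • u t
    have ρac : AbsolutelyContinuousOnInterval ρ 0 1 := by
      refine ac_of_dist_le (C := ε) hηac fun s _ t _ => ?_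
      simp only [ρ, Real.dist_eq]
      rw [show 1 - ε * η s - (1 - ε * η t) = -(ε * (η s - η t)) by ring, abs_neg, abs_mul,
        abs_of_pos hε]
    have vd : ∀ᵐ t, t ∈ Icc (0:ℝ) 1 → deriv v t =
        deriv u t - ε • (η t • deriv u t + deriv η t • u t) := by
      filter_upwards [A.der, hηd] with t h1 h2 ht
      have d1 : HasDerivAt ρ (-(ε * deriv η t)) t := by
        simpa [ρ] using ((h2 ht).const_mul ε).const_sub 1
      have d2 := d1.smul (h1 ht)
      have d3 : deriv v t = _ := d2.deriv
      rw [d3]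
      simp only [ρ]
      module
    have zb : ∀ t ∈ Icc (0:ℝ) 1, ‖η t • deriv u t + deriv η t • u t‖ ^ 2 ≤ G t := by
      intro t ht
      have e1 : ‖η t • deriv u t‖ ≤ ‖deriv u t‖ := by
        rw [norm_smul, Real.norm_of_nonneg (h0 t)]
        exact mul_le_of_le_one_left (norm_nonneg _) (h1 t)
      have e2 : ‖deriv η t • u t‖ ≤ C * ‖q‖ := by
        rw [norm_smul]
        exact mul_le_mul (norm_deriv_le_of_lipschitz hη) (A.bd t ht) (norm_nonneg _) C.coe_nonneg
      have e3 := norm_add_le (η t • deriv u t) (deriv η t • u t)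
      have e4 : ‖η t • deriv u t + deriv η t • u t‖ ^ 2 ≤ (‖deriv u t‖ + C * ‖q‖) ^ 2 :=
        pow_le_pow_left₀ (norm_nonneg _) (by linarith) 2
      simp only [G]
      nlinarith [sq_nonneg (‖deriv u t‖ - C * ‖q‖)]
    have kb : ∀ᵐ t, t ∈ Icc (0:ℝ) 1 → ‖deriv v t‖ ^ 2 ≤ ‖deriv u t‖ ^ 2 - 2 * ε * X t + ε ^ 2 * G t := by
      filter_upwards [vd] with t h1 ht
      rw [h1 ht, norm_sub_sq_real, inner_smul_right, inner_add_right, inner_smul_right,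
        inner_smul_right, real_inner_self_eq_norm_sq, norm_smul, mul_pow, Real.norm_eq_abs, sq_abs]
      have := mul_le_mul_of_nonneg_left (zb t ht) (sq_nonneg ε)
      simp only [X]
      linarith
    have iB : IntervalIntegrable (fun t => ‖deriv u t‖ ^ 2 - 2 * ε * X t + ε ^ 2 * G t) volume 0 1 :=
      (A.iK.sub (iX.const_mul _)).add (iG.const_mul _)
    have viK : IntervalIntegrable (fun t => ‖deriv v t‖ ^ 2) volume 0 1 := by
      refine iB.mono_fun ((stronglyMeasurable_deriv v).aestronglyMeasurable.norm.pow 2) ?_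
      refine (ae_restrict_iff' measurableSet_uIoc).2 ?_
      filter_upwards [kb] with t h1 ht
      rw [uIoc_of_le zero_le_one] at ht
      have := h1 (Ioc_subset_Icc_self ht)
      rw [Real.norm_of_nonneg (by positivity)]
      exact this.trans (le_abs_self _)
    have vV : ∀ t, Vpot α U (v t) ≤ (Vpot α U (u t) + ε * α * (η t * Vpot α U (u t))
        + ε ^ 2 * 13 * Vpot α U (u t)) := by
      intro t
      simp only [v]
      rw [vpot_hom (ρ0 t)]
      have e1 := rpow_taylor H.hα (p0 t) (p1 t)
      have e2 : ρ t ^ (-α) ≤ 1 + α * (ε * η t) + 13 * ε ^ 2 := e1.trans (by linarith [p2 t])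
      have := mul_le_mul_of_nonneg_right e2 (H.v_nn (u t))
      linarith
    have iC : IntervalIntegrable (fun t => Vpot α U (u t) + ε * α * (η t * Vpot α U (u t))
        + ε ^ 2 * 13 * Vpot α U (u t)) volume 0 1 :=
      (A.iV.add (iηV.const_mul _)).add (A.iV.const_mul _)
    have viV : IntervalIntegrable (fun t => Vpot α U (v t)) volume 0 1 := by
      refine iC.mono_fun ?_ ?_
      · exact ((vpot_meas H.hU).comp_aemeasurable
          (ρc.aestronglyMeasurable.smul hum).aemeasurable).aestronglyMeasurable
      · refine Eventually.of_forall fun t => ?_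
        beta_reduce
        rw [Real.norm_of_nonneg (H.v_nn _)]
        exact (vV t).trans (le_abs_self _)
    have hv : HcA α h U q v := by
      refine ⟨ρac.smul A.ac, ?_, ?_, ?_, ?_, viK, intervalIntegrable_const.add viV⟩
      · simp [v, ρ, hη0, A.u0]
      · simp [v, A.u1]
      · intro t ht
        simp only [v]
        rw [norm_smul, Real.norm_of_nonneg (ρ0 t).le]
        exact (mul_le_of_le_one_left (norm_nonneg _) (ρ1 t)).trans (A.bd t ht)
      · filter_upwards [A.nz] with t h1 ht
        exact smul_ne_zero (ρ0 t).ne' (h1 ht)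
    have bK : Kf v ≤ Kf u - ε * (∫ t in (0:ℝ)..1, X t) + ε ^ 2 * ((1/2) * ∫ t in (0:ℝ)..1, G t) := by
      have := intervalIntegral.integral_mono_ae_restrict zero_le_one viK iB
        ((ae_restrict_iff' measurableSet_Icc).2 kb)
      rw [intervalIntegral.integral_add (A.iK.sub (iX.const_mul _)) (iG.const_mul _),
        intervalIntegral.integral_sub A.iK (iX.const_mul _), intervalIntegral.integral_const_mul,
        intervalIntegral.integral_const_mul] at this
      simp only [Kf]
      linarith
    have bP : Pf α h U v ≤ Pf α h U u + ε * (α * ∫ t in (0:ℝ)..1, η t * Vpot α U (u t)) +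
        ε ^ 2 * (13 * ∫ t in (0:ℝ)..1, Vpot α U (u t)) := by
      have := intervalIntegral.integral_mono zero_le_one viV iC vV
      rw [intervalIntegral.integral_add (A.iV.add (iηV.const_mul _)) (A.iV.const_mul _),
        intervalIntegral.integral_add A.iV (iηV.const_mul _), intervalIntegral.integral_const_mul,
        intervalIntegral.integral_const_mul] at this
      simp only [Pf]
      rw [intervalIntegral.integral_add intervalIntegrable_const viV,
        intervalIntegral.integral_add intervalIntegrable_const A.iV]
      linarith
    have hm := M.add_min H hv
    rw [← hcd] at hm
    have := mul_le_mul_of_nonneg_left bP hc.le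
    linarith
  have e1 : ∫ t in (0:ℝ)..1, deriv η t * inner ℝ (deriv u t) (u t) =
      (∫ t in (0:ℝ)..1, X t) - ∫ t in (0:ℝ)..1, η t * ‖deriv u t‖ ^ 2 := by
    simp only [X]
    rw [intervalIntegral.integral_add iηK iJ]; ring
  have e2 : ∫ t in (0:ℝ)..1, η t * ‖deriv u t‖ ^ 2 =
      ∫ t in (0:ℝ)..1, (2 * c * h * η t + 2 * c * (η t * Vpot α U (u t))) := by
    apply intervalIntegral.integral_congr_ae
    filter_upwards [M.energy_ae H] with t h1 ht
    rw [uIoc_of_le zero_le_one] at ht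
    rw [h1 (Ioc_subset_Icc_self ht)]
    ring
  have e3 : 0 ≤ ∫ t in (0:ℝ)..1, (2 * h * η t + (2 - α) * (η t * Vpot α U (u t))) := by
    apply intervalIntegral.integral_nonneg_of_ae_restrict zero_le_one
    refine (ae_restrict_iff' measurableSet_Icc).2 ?_
    filter_upwards [A.nz] with t h1 ht
    have := H.v_key (h1 ht) (A.bd t ht)
    have := mul_nonneg (h0 t) this.le
    simp only [Pi.zero_apply]
    linarith
  rw [intervalIntegral.integral_add (iη.const_mul _) (iηV.const_mul _),
    intervalIntegral.integral_const_mul, intervalIntegral.integral_const_mul] at e2 e3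
  rw [e1, e2]
  have := mul_nonneg hc.le e3
  linarith

end IsMinA

noncomputable def tent (a m b : ℝ) (t : ℝ) : ℝ :=
  max 0 (min ((m - a)⁻¹ * (t - a)) ((b - m)⁻¹ * (b - t)))

lemma tent_lip (a m b : ℝ) : ∃ C, LipschitzWith C (tent a m b) := by
  have h1 : LipschitzWith (Real.nnabs (m - a)⁻¹) (fun t => (m - a)⁻¹ * (t - a)) := by
    apply LipschitzWith.of_dist_le_mul
    intro x y
    rw [Real.dist_eq, Real.dist_eq, ← mul_sub, abs_mul]
    simp
  have h2 : LipschitzWith (Real.nnabs (b - m)⁻¹) (fun t => (b - m)⁻¹ * (b - t)) := by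
    apply LipschitzWith.of_dist_le_mul
    intro x y
    rw [Real.dist_eq, Real.dist_eq, ← mul_sub, abs_mul, show b - x - (b - y) = -(x - y) by ring, abs_neg]
    simp
  exact ⟨_, (h1.min h2).const_max 0⟩

section tent
variable {a m b t : ℝ}

lemma tent_nn : 0 ≤ tent a m b t := le_max_left _ _

lemma tent_le_one (ham : a < m) (hmb : m < b) : tent a m b t ≤ 1 := by
  have h1 : 0 < m - a := by linarith
  have h2 : 0 < b - m := by linarith
  unfold tent
  refine max_le zero_le_one ?_
  rcases le_total t m with h | h
  · refine (min_le_left _ _).trans ?_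
    rw [inv_mul_le_one₀ h1]; linarith
  · refine (min_le_right _ _).trans ?_
    rw [inv_mul_le_one₀ h2]; linarith

lemma tent_left (ham : a < m) (ht : t ≤ a) : tent a m b t = 0 := by
  unfold tent
  refine max_eq_left ((min_le_left _ _).trans ?_)
  exact mul_nonpos_of_nonneg_of_nonpos (inv_nonneg.2 (by linarith)) (by linarith)

lemma tent_right (hmb : m < b) (ht : b ≤ t) : tent a m b t = 0 := by
  unfold tent
  refine max_eq_left ((min_le_right _ _).trans ?_)
  exact mul_nonpos_of_nonneg_of_nonpos (inv_nonneg.2 (by linarith)) (by linarith)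

lemma tent_mid1 (ham : a < m) (hmb : m < b) (h1 : a ≤ t) (h2 : t ≤ m) :
    tent a m b t = (m - a)⁻¹ * (t - a) := by
  have g1 : 0 < m - a := by linarith
  have g2 : 0 < b - m := by linarith
  unfold tent
  rw [min_eq_left, max_eq_right]
  · exact mul_nonneg (inv_nonneg.2 g1.le) (by linarith)
  · have e1 : (m - a)⁻¹ * (t - a) ≤ 1 := by rw [inv_mul_le_one₀ g1]; linarith
    have e2 : 1 ≤ (b - m)⁻¹ * (b - t) := by rw [one_le_inv_mul₀ g2]; linarith
    linarith

lemma tent_mid2 (ham : a < m) (hmb : m < b) (h1 : m ≤ t) (h2 : t ≤ b) :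
    tent a m b t = (b - m)⁻¹ * (b - t) := by
  have g1 : 0 < m - a := by linarith
  have g2 : 0 < b - m := by linarith
  unfold tent
  rw [min_eq_right, max_eq_right]
  · exact mul_nonneg (inv_nonneg.2 g2.le) (by linarith)
  · have e1 : (b - m)⁻¹ * (b - t) ≤ 1 := by rw [inv_mul_le_one₀ g2]; linarith
    have e2 : 1 ≤ (m - a)⁻¹ * (t - a) := by rw [one_le_inv_mul₀ g1]; linarith
    linarith

lemma tent_int {J : ℝ → ℝ} (h0a : 0 ≤ a) (ham : a < m) (hmb : m < b) (hb1 : b ≤ 1)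
    (hi : IntervalIntegrable (fun t => deriv (tent a m b) t * J t) volume 0 1) :
    ∫ t in (0:ℝ)..1, deriv (tent a m b) t * J t =
      (m - a)⁻¹ * (∫ t in a..m, J t) - (b - m)⁻¹ * ∫ t in m..b, J t := by
  have m0 : (0:ℝ) ∈ Icc (0:ℝ) 1 := by simp
  have m1 : (1:ℝ) ∈ Icc (0:ℝ) 1 := by simp
  have ma : a ∈ Icc (0:ℝ) 1 := ⟨h0a, by linarith⟩
  have mm : m ∈ Icc (0:ℝ) 1 := ⟨by linarith, by linarith⟩
  have mb : b ∈ Icc (0:ℝ) 1 := ⟨by linarith, by linarith⟩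
  rw [← integral_add_adjacent_intervals (ii_sub hi m0 mb) (ii_sub hi mb m1),
    ← integral_add_adjacent_intervals (ii_sub hi m0 mm) (ii_sub hi mm mb),
    ← integral_add_adjacent_intervals (ii_sub hi m0 ma) (ii_sub hi ma mm)]
  have key : ∀ {s t k l : ℝ}, s ≤ t → (∀ x ∈ Ioo s t, tent a m b x = k * x + l) →
      ∫ x in s..t, deriv (tent a m b) x * J x = k * ∫ x in s..t, J x := by
    intro s t k l hst hx
    rw [← intervalIntegral.integral_const_mul]
    apply intervalIntegral.integral_congr_Ioo_of_le hst
    intro x hx'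
    have : deriv (tent a m b) x = k := by
      have e : tent a m b =ᶠ[𝓝 x] fun x => k * x + l := by
        filter_upwards [isOpen_Ioo.mem_nhds hx'] with y hy using hx y hy
      rw [e.deriv_eq]
      simpa using ((hasDerivAt_id x).const_mul k |>.add_const l).deriv
    simp only [this]
  rw [key (k := 0) (l := 0) h0a (fun x hx => by rw [tent_left ham hx.2.le]; ring),
    key (k := (m - a)⁻¹) (l := - ((m - a)⁻¹ * a)) ham.le
      (fun x hx => by rw [tent_mid1 ham hmb hx.1.le hx.2.le]; ring),
    key (k := -(b - m)⁻¹) (l := (b - m)⁻¹ * b) hmb.le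
      (fun x hx => by rw [tent_mid2 ham hmb hx.1.le hx.2.le]; ring),
    key (k := 0) (l := 0) hb1 (fun x hx => by rw [tent_right hmb hx.1.le]; ring)]
  ring

end tent

namespace IsMinA

variable {α h Umin : ℝ} {U : E2 → ℝ} {q : E2} {u : ℝ → E2}

lemma convex (H : Hyp α h Umin U q) (M : IsMinA α h U q u) :
    ConvexOn ℝ (Icc 0 1) (fun t => ‖u t‖ ^ 2) := by
  have A := M.A
  have Iac : AbsolutelyContinuousOnInterval (fun t => ‖u t‖ ^ 2) 0 1 := by
    refine ac_of_dist_le (C := 2 * ‖q‖) A.ac fun s hs t ht => ?_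
    rw [uIcc_of_le zero_le_one] at hs ht
    have b1 := A.bd s hs
    have b2 := A.bd t ht
    rw [Real.dist_eq, dist_eq_norm, show ‖u s‖ ^ 2 - ‖u t‖ ^ 2 = (‖u s‖ + ‖u t‖) * (‖u s‖ - ‖u t‖) by ring,
      abs_mul, abs_of_nonneg (by positivity)]
    exact mul_le_mul (by linarith) (abs_norm_sub_norm_le _ _) (abs_nonneg _) (by positivity)
  have Iint : ∀ s t, s ∈ Icc (0:ℝ) 1 → t ∈ Icc (0:ℝ) 1 →
      ∫ x in s..t, inner ℝ (deriv u x) (u x) = (‖u t‖ ^ 2 - ‖u s‖ ^ 2) / 2 := by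
    intro s t hs ht
    have hsub : uIcc s t ⊆ uIcc 0 1 :=
      uIcc_subset_uIcc (by rwa [uIcc_of_le zero_le_one]) (by rwa [uIcc_of_le zero_le_one])
    have := ac_ftc_real (f := fun x => 2 * inner ℝ (deriv u x) (u x)) (Iac.mono hsub) (by
      filter_upwards [A.der] with x hx hx'
      have := (hx (by simpa [uIcc_of_le] using hsub hx')).norm_sq
      rwa [real_inner_comm] at this)
    rw [intervalIntegral.integral_const_mul] at this
    linarith
  refine convexOn_of_slope_mono_adjacent (convex_Icc 0 1) ?_
  intro a m b ha hb ham hmb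
  obtain ⟨C, hC⟩ := tent_lip a m b
  have mm : m ∈ Icc (0:ℝ) 1 := ⟨by linarith [ha.1], by linarith [hb.2]⟩
  have h1 := M.first_var H hC (fun _ => tent_nn) (fun _ => tent_le_one ham hmb) (tent_left ham ha.1)
  rw [tent_int ha.1 ham hmb hb.2 (M.ii_eta_inner hC), Iint _ _ ha mm, Iint _ _ mm hb] at h1
  rw [div_eq_inv_mul, div_eq_inv_mul]
  linarith

lemma ne_zero (H : Hyp α h Umin U q) (M : IsMinA α h U q u) {t : ℝ} (ht : t ∈ Ico (0:ℝ) 1) :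
    u t ≠ 0 := by
  intro h0
  have hc := M.convex H
  have m1 : (1:ℝ) ∈ Icc (0:ℝ) 1 := by simp
  have hz : ∀ s ∈ Icc t 1, u s = 0 := by
    intro s hs
    have := hc.le_max_of_mem_Icc (Ico_subset_Icc_self ht) m1 hs
    simp only [h0, M.A.u1] at this
    simpa using this
  have h2 := M.A.nz
  rw [ae_iff] at h2
  have h3 : volume (Icc t 1) ≤ 0 := by
    rw [← h2]
    apply measure_mono
    intro s hs
    simp only [mem_setOf_eq, not_forall, not_not]
    exact ⟨⟨ht.1.trans hs.1, hs.2⟩, hz s hs⟩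
  rw [Real.volume_Icc] at h3
  simp at h3
  linarith [ht.2]

end IsMinA

lemma glue_ii {F : Type*} [NormedAddCommGroup F] [NormedSpace ℝ F] {f g : ℝ → F} {p b r : ℝ}
    (hb : b ∈ Icc p r) (hf : IntervalIntegrable f volume p b)
    (hg : IntervalIntegrable g volume b r) :
    IntervalIntegrable (fun t => if t ≤ b then f t else g t) volume p r ∧
    (∀ t ∈ Icc p b, ∫ s in p..t, (if s ≤ b then f s else g s) = ∫ s in p..t, f s) ∧
    (∀ t ∈ Icc b r, ∫ s in p..t, (if s ≤ b then f s else g s) =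
      (∫ s in p..b, f s) + ∫ s in b..t, g s) := by
  have h1 : IntervalIntegrable (fun t => if t ≤ b then f t else g t) volume p b := by
    refine hf.congr fun t ht => ?_
    rw [uIoc_of_le hb.1] at ht
    simp [ht.2]
  have h2 : IntervalIntegrable (fun t => if t ≤ b then f t else g t) volume b r := by
    refine hg.congr fun t ht => ?_
    rw [uIoc_of_le hb.2] at ht
    simp [not_le.2 ht.1]
  have h3 : ∀ t ∈ Icc p b, ∫ s in p..t, (if s ≤ b then f s else g s) = ∫ s in p..t, f s := by
    intro t ht
    apply intervalIntegral.integral_congr_ae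
    refine Eventually.of_forall fun s hs => ?_
    rw [uIoc_of_le ht.1] at hs
    simp [hs.2.trans ht.2]
  refine ⟨h1.trans h2, h3, fun t ht => ?_⟩
  rw [← integral_add_adjacent_intervals h1 (h2.mono_set (uIcc_subset_uIcc_left
    (by rw [uIcc_of_le hb.2]; exact ht))), h3 b ⟨hb.1, le_rfl⟩]
  congr 1
  apply intervalIntegral.integral_congr_ae
  refine Eventually.of_forall fun s hs => ?_
  rw [uIoc_of_le ht.1] at hs
  simp [not_le.2 hs.1]

/-- replace `w` by `g` on `(s1, s2]` -/
noncomputable def patch {F : Type*} (s1 s2 : ℝ) (w g : ℝ → F) (t : ℝ) : F :=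
  if t ≤ s1 then w t else if t ≤ s2 then g t else w t

lemma patch_ii {F : Type*} [NormedAddCommGroup F] [NormedSpace ℝ F] {w g : ℝ → F} {s1 s2 : ℝ}
    (h0 : 0 ≤ s1) (h12 : s1 ≤ s2) (h2 : s2 ≤ 1)
    (hw : IntervalIntegrable w volume 0 1) (hg : IntervalIntegrable g volume s1 s2) :
    IntervalIntegrable (patch s1 s2 w g) volume 0 1 ∧
    (∀ t ∈ Icc 0 s1, ∫ s in (0:ℝ)..t, patch s1 s2 w g s = ∫ s in (0:ℝ)..t, w s) ∧
    (∀ t ∈ Icc s1 s2, ∫ s in (0:ℝ)..t, patch s1 s2 w g s =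
      (∫ s in (0:ℝ)..s1, w s) + ∫ s in s1..t, g s) ∧
    (∀ t ∈ Icc s2 1, ∫ s in (0:ℝ)..t, patch s1 s2 w g s =
      (∫ s in (0:ℝ)..s1, w s) + ((∫ s in s1..s2, g s) + ∫ s in s2..t, w s)) := by
  have m0 : (0:ℝ) ∈ Icc (0:ℝ) 1 := by simp
  have m1 : (1:ℝ) ∈ Icc (0:ℝ) 1 := by simp
  have ms1 : s1 ∈ Icc (0:ℝ) 1 := ⟨h0, by linarith⟩
  have ms2 : s2 ∈ Icc (0:ℝ) 1 := ⟨by linarith, h2⟩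
  obtain ⟨a1, a2, a3⟩ := glue_ii (p := s1) (r := 1) ⟨h12, h2⟩ hg (ii_sub hw ms2 m1)
  obtain ⟨b1, b2, b3⟩ := glue_ii ms1 (ii_sub hw m0 ms1) a1
  refine ⟨b1, b2, fun t ht => ?_, fun t ht => ?_⟩
  · unfold patch
    rw [b3 t ⟨ht.1, ht.2.trans h2⟩, a2 t ht]
  · unfold patch
    rw [b3 t ⟨h12.trans ht.1, ht.2⟩, a3 t ht]

namespace IsMinA

variable {α h Umin : ℝ} {U : E2 → ℝ} {q : E2} {u : ℝ → E2}

lemma chord_cmp (H : Hyp α h Umin U q) (M : IsMinA α h U q u) {s1 s2 : ℝ}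
    (h0 : 0 ≤ s1) (h12 : s1 < s2) (h2 : s2 ≤ 1)
    (hl : ∀ t ∈ Icc s1 s2, u s1 + (t - s1) • ((s2 - s1)⁻¹ • (u s2 - u s1)) ≠ 0) :
    2 * (Kf u / Pf α h U u * ∫ s in s1..s2, (h + Vpot α U (u s))) ≤
      (1/2) * (‖u s2 - u s1‖ ^ 2 / (s2 - s1)) + Kf u / Pf α h U u *
        ∫ s in s1..s2, (h + Vpot α U (u s1 + (s - s1) • ((s2 - s1)⁻¹ • (u s2 - u s1)))) := by
  have A := M.A
  have m0 : (0:ℝ) ∈ Icc (0:ℝ) 1 := by simp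
  have m1 : (1:ℝ) ∈ Icc (0:ℝ) 1 := by simp
  have ms1 : s1 ∈ Icc (0:ℝ) 1 := ⟨h0, by linarith⟩
  have ms2 : s2 ∈ Icc (0:ℝ) 1 := ⟨by linarith, h2⟩
  have hd0 : 0 < s2 - s1 := by linarith
  set c := Kf u / Pf α h U u with hc
  set d := (s2 - s1)⁻¹ • (u s2 - u s1) with hd
  have hd2 : (s2 - s1) • d = u s2 - u s1 := by rw [hd, smul_inv_smul₀ hd0.ne']
  set l : ℝ → E2 := fun t => u s1 + (t - s1) • d with hlD
  have lc : Continuous l := by fun_prop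
  let v := patch s1 s2 u l
  let w := patch s1 s2 (deriv u) (fun _ => d)
  have ig : IntervalIntegrable (fun s => h + Vpot α U (l s)) volume s1 s2 := by
    apply ContinuousOn.intervalIntegrable
    rw [uIcc_of_le h12.le]
    intro t ht
    have := (vpot_cont (α := α) H.hU (hl t ht)).comp (f := l) lc.continuousAt
    exact (continuousAt_const.add this).continuousWithinAt
  obtain ⟨w1, w2, w3, w4⟩ := patch_ii h0 h12.le h2 A.iw
    (intervalIntegrable_const (a := s1) (b := s2) (c := d) (μ := volume))
  obtain ⟨k1, -, -, k4⟩ := patch_ii h0 h12.le h2 A.iK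
    (intervalIntegrable_const (a := s1) (b := s2) (c := ‖d‖ ^ 2) (μ := volume))
  obtain ⟨p1, -, -, p4⟩ := patch_ii h0 h12.le h2 A.iP ig
  have ew : (fun t => ‖w t‖ ^ 2) = patch s1 s2 (fun t => ‖deriv u t‖ ^ 2) (fun _ => ‖d‖ ^ 2) := by
    funext t; simp only [w, patch]; split_ifs <;> rfl
  have ep : (fun t => h + Vpot α U (v t)) =
      patch s1 s2 (fun t => h + Vpot α U (u t)) (fun s => h + Vpot α U (l s)) := by
    funext t; simp only [v, patch]; split_ifs <;> rfl
  have rep : ∀ t ∈ Icc (0:ℝ) 1, v t = q + ∫ s in (0:ℝ)..t, w s := by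
    intro t ht
    simp only [w]
    by_cases c1 : t ≤ s1
    · rw [w2 t ⟨ht.1, c1⟩, A.ftc m0 ht, A.u0]
      simp [v, patch, c1]
    · by_cases c2 : t ≤ s2
      · rw [w3 t ⟨(not_le.1 c1).le, c2⟩, A.ftc m0 ms1, A.u0, intervalIntegral.integral_const]
        simp [v, patch, c1, c2, hlD]
        abel
      · rw [w4 t ⟨(not_le.1 c2).le, ht.2⟩, A.ftc m0 ms1, A.u0, intervalIntegral.integral_const,
          A.ftc ms2 ht, hd2]
        simp [v, patch, c1, c2]
  have lb : ∀ t ∈ Icc s1 s2, ‖l t‖ ≤ ‖q‖ := by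
    intro t ht
    have e : l t = (1 - (t - s1) / (s2 - s1)) • u s1 + ((t - s1) / (s2 - s1)) • u s2 := by
      simp only [hlD, hd]
      rw [div_eq_mul_inv]
      module
    have x0 : 0 ≤ (t - s1) / (s2 - s1) := div_nonneg (by linarith [ht.1]) hd0.le
    have x1 : (t - s1) / (s2 - s1) ≤ 1 := by rw [div_le_one hd0]; linarith [ht.2]
    have hcv := convex_closedBall (0:E2) ‖q‖
    have := hcv (x := u s1) (by simpa using A.bd s1 ms1) (y := u s2) (by simpa using A.bd s2 ms2)
      (a := 1 - (t - s1) / (s2 - s1)) (b := (t - s1) / (s2 - s1)) (by linarith) x0 (by ring)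
    rw [← e] at this
    simpa using this
  obtain ⟨hA, hK⟩ := hcA_of_rep (α := α) (h := h) (U := U) (q := q) (u := v) (w := w)
    w1 (by rw [ew]; exact k1) rep
    (by
      by_cases hs : s2 = 1
      · simp only [v, patch]
        rw [if_neg (by linarith), if_pos hs.ge]
        simp only [hlD]
        rw [← hs, hd2, hs, A.u1]; simp
      · have : ¬ (1 ≤ s2) := fun h => hs (le_antisymm h2 h)
        simp only [v, patch]
        rw [if_neg (by linarith), if_neg this, A.u1])
    (by
      intro t ht
      simp only [v, patch]
      split_ifs with c1 c2
      · exact A.bd t ht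
      · exact lb t ⟨(not_le.1 c1).le, c2⟩
      · exact A.bd t ht)
    (by
      filter_upwards [A.nz] with t h1 ht
      simp only [v, patch]
      split_ifs with c1 c2
      · exact h1 ht
      · exact hl t ⟨(not_le.1 c1).le, c2⟩
      · exact h1 ht)
    (by rw [ep]; exact p1)
  have hm := M.add_min H hA
  have hE := M.energy_sub H ms1 ms2
  rw [← hc] at hm hE
  have hKv : Kf v = (1/2) * ((∫ s in (0:ℝ)..s1, ‖deriv u s‖ ^ 2) +
      (‖u s2 - u s1‖ ^ 2 / (s2 - s1) + ∫ s in s2..1, ‖deriv u s‖ ^ 2)) := by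
    rw [Kf, hK, ew, k4 1 ⟨h2, le_rfl⟩, intervalIntegral.integral_const]
    congr 3
    rw [hd, norm_smul, norm_inv, Real.norm_of_nonneg hd0.le, smul_eq_mul]
    field_simp
  have hPv : Pf α h U v = (∫ s in (0:ℝ)..s1, (h + Vpot α U (u s))) +
      ((∫ s in s1..s2, (h + Vpot α U (l s))) + ∫ s in s2..1, (h + Vpot α U (u s))) := by
    rw [Pf, ep, p4 1 ⟨h2, le_rfl⟩]
  have hKu : Kf u = (1/2) * ((∫ s in (0:ℝ)..s1, ‖deriv u s‖ ^ 2) +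
      ((∫ s in s1..s2, ‖deriv u s‖ ^ 2) + ∫ s in s2..1, ‖deriv u s‖ ^ 2)) := by
    rw [integral_add_adjacent_intervals (ii_sub A.iK ms1 ms2) (ii_sub A.iK ms2 m1),
      integral_add_adjacent_intervals (ii_sub A.iK m0 ms1) (ii_sub A.iK ms1 m1), Kf]
  have hPu : Pf α h U u = (∫ s in (0:ℝ)..s1, (h + Vpot α U (u s))) +
      ((∫ s in s1..s2, (h + Vpot α U (u s))) + ∫ s in s2..1, (h + Vpot α U (u s))) := by
    rw [integral_add_adjacent_intervals (ii_sub A.iP ms1 ms2) (ii_sub A.iP ms2 m1),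
      integral_add_adjacent_intervals (ii_sub A.iP m0 ms1) (ii_sub A.iP ms1 m1), Pf]
  clear_value c
  rw [hKv, hPv] at hm
  rw [hPu, hKu] at hm
  linarith

lemma chord (H : Hyp α h Umin U q) (M : IsMinA α h U q u) {t0 : ℝ} (ht0 : t0 ∈ Ioo (0:ℝ) 1)
    {ε : ℝ} (hε : 0 < ε) : ∃ δ > 0, ∀ s1 s2, t0 - δ < s1 → s1 ≤ t0 → t0 ≤ s2 → s2 < t0 + δ → s1 < s2 →
      |‖u s2 - u s1‖ ^ 2 / (s2 - s1) ^ 2 - 2 * (Kf u / Pf α h U u) * (h + Vpot α U (u t0))| ≤ ε := by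
  have A := M.A
  have hc := M.c_pos H
  set c := Kf u / Pf α h U u with hcd
  set V0 := h + Vpot α U (u t0) with hV0
  have hnz := M.ne_zero H ⟨ht0.1.le, ht0.2⟩
  set e := ε / (6 * c) with he
  have he0 : 0 < e := by positivity
  have hce : 6 * c * e = ε := by rw [he]; field_simp
  have n1 : ∀ᶠ x in 𝓝 (u t0), |Vpot α U x - Vpot α U (u t0)| < e := by
    have := (vpot_cont (α := α) H.hU hnz).eventually (Metric.ball_mem_nhds _ he0)
    filter_upwards [this] with x hx
    simpa [Real.dist_eq] using hx
  obtain ⟨r, hr, hball⟩ := Metric.eventually_nhds_iff_ball.1 (n1.and (isOpen_ne.mem_nhds hnz))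
  have hca : ContinuousAt u t0 := A.cont.continuousAt (Icc_mem_nhds ht0.1 ht0.2)
  obtain ⟨δ, hδ, hδb⟩ := Metric.eventually_nhds_iff_ball.1
    ((hca.eventually (Metric.ball_mem_nhds _ hr)).and (Ioo_mem_nhds ht0.1 ht0.2))
  refine ⟨δ, hδ, fun s1 s2 a1 a2 a3 a4 a5 => ?_⟩
  have hin : ∀ t ∈ Icc s1 s2, u t ∈ Metric.ball (u t0) r ∧ t ∈ Ioo (0:ℝ) 1 := by
    intro t ht
    apply hδb
    rw [Metric.mem_ball, Real.dist_eq, abs_lt]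
    constructor <;> linarith [ht.1, ht.2]
  have i1 := hin s1 ⟨le_rfl, a5.le⟩
  have i2 := hin s2 ⟨a5.le, le_rfl⟩
  have ms1 : s1 ∈ Icc (0:ℝ) 1 := Ioo_subset_Icc_self i1.2
  have ms2 : s2 ∈ Icc (0:ℝ) 1 := Ioo_subset_Icc_self i2.2
  have hd0 : 0 < s2 - s1 := by linarith
  set D := s2 - s1 with hD
  have lb : ∀ t ∈ Icc s1 s2, u s1 + (t - s1) • (D⁻¹ • (u s2 - u s1)) ∈ Metric.ball (u t0) r := by
    intro t ht
    have e : u s1 + (t - s1) • (D⁻¹ • (u s2 - u s1)) =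
        (1 - (t - s1) / D) • u s1 + ((t - s1) / D) • u s2 := by
      rw [div_eq_mul_inv]
      module
    have x0 : 0 ≤ (t - s1) / D := div_nonneg (by linarith [ht.1]) hd0.le
    have x1 : (t - s1) / D ≤ 1 := by rw [div_le_one hd0]; linarith [ht.2]
    rw [e]
    exact convex_ball (u t0) r i1.1 i2.1 (by linarith) x0 (by ring)
  have cmp := M.chord_cmp H ms1.1 a5 ms2.2 (fun t ht => (hball _ (lb t ht)).2)
  rw [← hcd, ← hD] at cmp
  have up : ∀ f : ℝ → E2, IntervalIntegrable (fun s => h + Vpot α U (f s)) volume s1 s2 →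
      (∀ t ∈ Icc s1 s2, f t ∈ Metric.ball (u t0) r) →
      ∫ s in s1..s2, (h + Vpot α U (f s)) ≤ D * (V0 + e) := by
    intro f hf hfb
    have := intervalIntegral.integral_mono_on a5.le hf
      (intervalIntegrable_const (c := V0 + e)) (fun t ht => by
        have := (abs_lt.1 (hball _ (hfb t ht)).1).2
        rw [hV0]; linarith)
    rwa [intervalIntegral.integral_const, smul_eq_mul] at this
  have lo : D * (V0 - e) ≤ ∫ s in s1..s2, (h + Vpot α U (u s)) := by
    have := intervalIntegral.integral_mono_on a5.le (intervalIntegrable_const (c := V0 - e))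
      (ii_sub A.iP ms1 ms2) (fun t ht => by
        have := (abs_lt.1 (hball _ (hin t ht).1).1).1
        rw [hV0]; linarith)
    rwa [intervalIntegral.integral_const, smul_eq_mul] at this
  have up1 := up u (ii_sub A.iP ms1 ms2) (fun t ht => (hin t ht).1)
  have up2 := up (fun t => u s1 + (t - s1) • (D⁻¹ • (u s2 - u s1))) (by
    apply ContinuousOn.intervalIntegrable
    rw [uIcc_of_le a5.le]
    intro t ht
    have lc : Continuous fun t => u s1 + (t - s1) • (D⁻¹ • (u s2 - u s1)) := by fun_prop
    have := (vpot_cont (α := α) H.hU (hball _ (lb t ht)).2).comp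
      (f := fun t => u s1 + (t - s1) • (D⁻¹ • (u s2 - u s1))) lc.continuousAt
    exact (continuousAt_const.add this).continuousWithinAt) lb
  have cs := A.cs a5 ms1 ms2
  have hE := M.energy_sub H ms1 ms2
  rw [← hcd] at hE
  rw [← hD] at cs
  set N := ‖u s2 - u s1‖ ^ 2 with hN
  have hN2 : N / D ^ 2 = (N / D) / D := by field_simp
  have hup : N / D ≤ 2 * c * (D * (V0 + e)) := by
    rw [div_le_iff₀ hd0]
    have := mul_le_mul_of_nonneg_left up1 hc.le
    have h3 : ∫ x in s1..s2, ‖deriv u x‖ ^ 2 ≤ 2 * c * (D * (V0 + e)) := by linarith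
    have := mul_le_mul_of_nonneg_left h3 hd0.le
    linarith
  have hlow : 2 * c * (D * (V0 - 3 * e)) ≤ N / D := by
    have h1 := mul_le_mul_of_nonneg_left up2 hc.le
    have h2 := mul_le_mul_of_nonneg_left lo hc.le
    linarith
  rw [hN2, abs_le]
  constructor
  · have : 2 * c * (V0 - 3 * e) ≤ N / D / D := by
      rw [le_div_iff₀ hd0]; linarith
    linarith
  · have : N / D / D ≤ 2 * c * (V0 + e) := by
      rw [div_le_iff₀ hd0]; linarith
    have : 0 < c * e := by positivity
    linarith

end IsMinA

lemma sq_conv {f : ℝ → ℝ} {r L : ℝ} (hr : 0 < r) (hf : ContinuousOn f (Ioo 0 r))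
    (hL : Tendsto (fun s => f s ^ 2) (𝓝[>] 0) (𝓝 L)) : ∃ l, Tendsto f (𝓝[>] 0) (𝓝 l) := by
  have habs : Tendsto (fun s => |f s|) (𝓝[>] 0) (𝓝 (Real.sqrt L)) := by
    have := (Real.continuous_sqrt.tendsto L).comp hL
    refine this.congr fun s => ?_
    simp [Real.sqrt_sq_eq_abs]
  have hL0 : 0 ≤ L := ge_of_tendsto' hL fun s => sq_nonneg _
  rcases hL0.eq_or_lt with rfl | hLp
  · refine ⟨0, ?_⟩
    rw [Real.sqrt_zero] at habs
    exact (tendsto_zero_iff_abs_tendsto_zero f).2 habs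
  · have h1 : ∀ᶠ s in 𝓝[>] (0:ℝ), 0 < f s ^ 2 := hL.eventually (lt_mem_nhds hLp)
    obtain ⟨r', hr', hsub⟩ := (mem_nhdsGT_iff_exists_Ioo_subset).1
      (h1.and (Ioo_mem_nhdsGT hr))
    have hS : IsPreconnected (Ioo 0 r') := isPreconnected_Ioo
    have hfS : ContinuousOn f (Ioo 0 r') := hf.mono fun s hs => (hsub hs).2
    have hmem : Ioo 0 r' ∈ 𝓝[>] (0:ℝ) := Ioo_mem_nhdsGT hr'
    rcases hS.eq_or_eq_neg_of_sq_eq hfS hfS.abs (fun s hs => by simp)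
      (fun {s} hs => by
        have := (hsub hs).1
        simp only [ne_eq, abs_eq_zero]
        intro h0
        rw [h0] at this
        simp at this) with h | h
    · refine ⟨Real.sqrt L, habs.congr' ?_⟩
      filter_upwards [hmem] with s hs using (h hs).symm
    · refine ⟨-Real.sqrt L, habs.neg.congr' ?_⟩
      filter_upwards [hmem] with s hs using (h hs).symm

/-- rotation by a quarter turn -/
noncomputable def rot (e : E2) : E2 := !₂[-(e 1), e 0]

lemma rot_id (e x : E2) : (inner ℝ (rot e) x) ^ 2 = ‖e‖ ^ 2 * ‖x‖ ^ 2 - (inner ℝ e x) ^ 2 := by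
  simp only [rot, PiLp.inner_apply, Fin.sum_univ_two, EuclideanSpace.norm_sq_eq, Real.norm_eq_abs,
    sq_abs]
  simp
  ring

lemma rot_dec (e x : E2) : ‖e‖ ^ 2 • x = (inner ℝ e x : ℝ) • e + (inner ℝ (rot e) x : ℝ) • rot e := by
  ext i
  fin_cases i <;>
  · simp [rot, PiLp.inner_apply, Fin.sum_univ_two, EuclideanSpace.norm_sq_eq, Real.norm_eq_abs, sq_abs]
    ring

namespace IsMinA

variable {α h Umin : ℝ} {U : E2 → ℝ} {q : E2} {u : ℝ → E2}

lemma diff (H : Hyp α h Umin U q) (M : IsMinA α h U q u) {t0 : ℝ} (ht0 : t0 ∈ Ioo (0:ℝ) 1) :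
    DifferentiableAt ℝ u t0 := by
  have A := M.A
  set B := 2 * (Kf u / Pf α h U u) * (h + Vpot α U (u t0)) with hB
  have hnz := M.ne_zero H ⟨ht0.1.le, ht0.2⟩
  set e := u t0 with he
  let Qp : ℝ → E2 := fun s => s⁻¹ • (u (t0 + s) - e)
  let Qm : ℝ → E2 := fun s => s⁻¹ • (e - u (t0 - s))
  have nsq : ∀ (s : ℝ) (x : E2), ‖s⁻¹ • x‖ ^ 2 = ‖x‖ ^ 2 / s ^ 2 := by
    intro s x
    rw [norm_smul, mul_pow, norm_inv, inv_pow, Real.norm_eq_abs, sq_abs]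
    ring
  have hp : Tendsto (fun s => ‖Qp s‖ ^ 2) (𝓝[>] 0) (𝓝 B) := by
    rw [Metric.tendsto_nhds]
    intro ε hε
    obtain ⟨δ, hδ, hch⟩ := M.chord H ht0 (half_pos hε)
    filter_upwards [Ioo_mem_nhdsGT hδ] with s hs
    have := hch t0 (t0 + s) (by linarith) le_rfl (by linarith [hs.1]) (by linarith [hs.2])
      (by linarith [hs.1])
    rw [Real.dist_eq]
    simp only [Qp]
    rw [nsq]
    rw [add_sub_cancel_left] at this
    linarith
  have hm : Tendsto (fun s => ‖Qm s‖ ^ 2) (𝓝[>] 0) (𝓝 B) := by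
    rw [Metric.tendsto_nhds]
    intro ε hε
    obtain ⟨δ, hδ, hch⟩ := M.chord H ht0 (half_pos hε)
    filter_upwards [Ioo_mem_nhdsGT hδ] with s hs
    have := hch (t0 - s) t0 (by linarith [hs.2]) (by linarith [hs.1]) le_rfl (by linarith)
      (by linarith [hs.1])
    rw [Real.dist_eq]
    simp only [Qm]
    rw [nsq]
    rw [sub_sub_cancel] at this
    linarith
  have hs : Tendsto (fun s => ‖Qp s + Qm s‖ ^ 2) (𝓝[>] 0) (𝓝 (4 * B)) := by
    have h1 : Tendsto (fun s => ‖u (t0 + s) - u (t0 - s)‖ ^ 2 / (2 * s) ^ 2) (𝓝[>] 0) (𝓝 B) := by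
      rw [Metric.tendsto_nhds]
      intro ε hε
      obtain ⟨δ, hδ, hch⟩ := M.chord H ht0 (half_pos hε)
      filter_upwards [Ioo_mem_nhdsGT hδ] with s hs
      have := hch (t0 - s) (t0 + s) (by linarith [hs.2]) (by linarith [hs.1]) (by linarith [hs.1])
        (by linarith [hs.2]) (by linarith [hs.1])
      rw [Real.dist_eq]
      rw [show t0 + s - (t0 - s) = 2 * s by ring] at this
      linarith
    refine (h1.const_mul 4).congr fun s => ?_
    simp only [Qp, Qm]
    rw [← smul_add, nsq, show u (t0 + s) - e + (e - u (t0 - s)) = u (t0 + s) - u (t0 - s) by abel]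
    rw [mul_pow, div_eq_mul_inv, div_eq_mul_inv, mul_inv]
    ring
  have hd : Tendsto (fun s => Qp s - Qm s) (𝓝[>] 0) (𝓝 0) := by
    rw [tendsto_zero_iff_norm_tendsto_zero]
    have h1 : Tendsto (fun s => ‖Qp s - Qm s‖ ^ 2) (𝓝[>] 0) (𝓝 0) := by
      have := ((hp.add hm).const_mul 2).sub hs
      rw [show 2 * (B + B) - 4 * B = 0 by ring] at this
      refine this.congr fun s => ?_
      have := parallelogram_law_with_norm ℝ (Qp s) (Qm s)
      linarith
    have h2 := (Real.continuous_sqrt.tendsto 0).comp h1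
    rw [Real.sqrt_zero] at h2
    refine h2.congr fun s => ?_
    simp
  have ht : Tendsto (fun s : ℝ => t0 + s) (𝓝[>] 0) (𝓝[>] t0) := by
    apply tendsto_nhdsWithin_of_tendsto_nhds_of_eventually_within
    · have : Continuous fun s : ℝ => t0 + s := by fun_prop
      have h2 := this.tendsto 0
      rw [add_zero] at h2
      exact h2.mono_left nhdsWithin_le_nhds
    · filter_upwards [self_mem_nhdsWithin] with s hs
      have : 0 < s := hs
      simp [this]
  obtain ⟨J, hJ⟩ : ∃ J, Tendsto (fun s => inner ℝ e (Qp s)) (𝓝[>] 0) (𝓝 J) := by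
    have hc := (M.convex H).hasDerivWithinAt_rightDeriv_of_mem_interior
      (x := t0) (by rwa [interior_Icc])
    rw [hasDerivWithinAt_iff_tendsto_slope' (by simp)] at hc
    have h1 := hc.comp ht
    have hid : Tendsto (fun s : ℝ => s) (𝓝[>] 0) (𝓝 0) := nhdsWithin_le_nhds
    have h2 := (h1.sub (hid.mul hp)).const_mul (1/2)
    refine ⟨_, h2.congr' ?_⟩
    filter_upwards [self_mem_nhdsWithin] with s hs
    have hs0 : s ≠ 0 := (show 0 < s from hs).ne'
    simp only [Function.comp, slope_def_field, Qp]
    rw [nsq, inner_smul_right, inner_sub_right, real_inner_self_eq_norm_sq, norm_sub_sq_real,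
      real_inner_comm, add_sub_cancel_left]
    field_simp
    ring
  have hD2 : Tendsto (fun s => (inner ℝ (rot e) (Qp s)) ^ 2) (𝓝[>] 0) (𝓝 (‖e‖ ^ 2 * B - J ^ 2)) := by
    refine ((hp.const_mul (‖e‖ ^ 2)).sub (hJ.pow 2)).congr fun s => ?_
    rw [rot_id]
  obtain ⟨l, hl⟩ := sq_conv (r := 1 - t0) (f := fun s => inner ℝ (rot e) (Qp s))
    (by linarith [ht0.2]) (by
      have hu : ContinuousOn (fun s => u (t0 + s)) (Ioo 0 (1 - t0)) := by
        refine A.cont.comp (by fun_prop) fun s hs => ?_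
        exact ⟨by linarith [hs.1, ht0.1], by linarith [hs.2]⟩
      have hi : ContinuousOn (fun s : ℝ => s⁻¹) (Ioo 0 (1 - t0)) :=
        continuousOn_inv₀.mono fun s hs => (show 0 < s from hs.1).ne'
      have hQ : ContinuousOn Qp (Ioo 0 (1 - t0)) := hi.smul (hu.sub continuousOn_const)
      exact continuousOn_const.inner hQ) hD2
  have he2 : ‖e‖ ^ 2 ≠ 0 := pow_ne_zero 2 (norm_ne_zero_iff.2 hnz)
  obtain ⟨w, hw⟩ : ∃ w, Tendsto Qp (𝓝[>] 0) (𝓝 w) := by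
    refine ⟨_, (((hJ.smul_const e).add (hl.smul_const (rot e))).const_smul (‖e‖ ^ 2)⁻¹).congr
      fun s => ?_⟩
    rw [← rot_dec, inv_smul_smul₀ he2]
  have hwm : Tendsto Qm (𝓝[>] 0) (𝓝 w) := by
    have := hw.sub hd
    rw [sub_zero] at this
    refine this.congr fun s => ?_
    abel
  have hder : HasDerivAt u w t0 := by
    rw [hasDerivAt_iff_tendsto_slope_zero, ← nhdsLT_sup_nhdsGT]
    refine Tendsto.sup ?_ hw
    have hn : Tendsto (fun s : ℝ => -s) (𝓝[<] 0) (𝓝[>] 0) := by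
      have := tendsto_neg_nhdsLT (a := (0:ℝ))
      rwa [neg_zero] at this
    refine (hwm.comp hn).congr fun s => ?_
    simp only [Function.comp, Qm]
    rw [sub_neg_eq_add, inv_neg, neg_smul, ← smul_neg, neg_sub]
  exact hder.differentiableAt

end IsMinA

theorem maupertuis_minimizer_exists
    (α h Umin : ℝ) (hα : α ∈ Set.Ioo (0:ℝ) 2) (hh : h < 0)
    (U : EuclideanSpace ℝ (Fin 2) → ℝ) (hUcont : Continuous U)
    (hUmin : ∀ s : EuclideanSpace ℝ (Fin 2), ‖s‖ = 1 → Umin ≤ U s)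
    (hUminpos : 0 < Umin)
    (q : EuclideanSpace ℝ (Fin 2)) (hq0 : q ≠ 0)
    (hqLJ : ‖q‖ < ((2 - α) * Umin / (-2 * h)) ^ (1/α)) :
    ∃ u, HcollQ α h U q u ∧
      (∀ v, HcollQ α h U q v → Maupertuis α h U u ≤ Maupertuis α h U v) ∧
      0 < Maupertuis α h U u := by
  have H : Hyp α h Umin U q := ⟨hα, hh, hUcont, hUmin, hUminpos, hq0, hqLJ⟩
  obtain ⟨u, A, hmin⟩ := exists_min H
  have M : IsMinA α h U q u := ⟨A, hmin⟩
  refine ⟨u, ⟨A.cont, fun s hs => M.diff H hs, A.u0, A.u1, A.bd, A.nz, A.iK, A.iP⟩,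
    fun v hv => ?_, ?_⟩
  · rw [maup_eq, maup_eq]
    exact hmin v (hcA_of_hcollQ hv)
  · rw [maup_eq]
    exact mul_pos (A.K_pos H) (A.P_pos H)
end

section
/- Jacobi length Lipschitz estimate: for h < 0, r ∈ (0, r_LJ), define ω_h(q) = inf over H_coll^q of the Jacobi length L_h(u) = ∫₀¹ |u̇| √(h+V(u)). Then for q₁ = r e^{iθ₁}, q₂ = r e^{iθ₂} on ∂B_r, |ω_h(q₁) − ω_h(q₂)| ≤ L |θ₁ − θ₂| with L = r_LJ^{1−α/2} √(U_max). -/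
open Set MeasureTheory intervalIntegral

/-- The Jacobi-length functional `L_h(u) = ∫₀¹ |u̇| √(h+V(u))`. -/
noncomputable def JacobiLen (α h : ℝ) (U : EuclideanSpace ℝ (Fin 2) → ℝ)
    (u : ℝ → EuclideanSpace ℝ (Fin 2)) : ℝ :=
  ∫ s in (0:ℝ)..1, ‖deriv u s‖ * Real.sqrt (h + Vpot α U (u s))

/-- The point `r e^{iθ}` of the plane. -/
noncomputable def circlePt (r θ : ℝ) : EuclideanSpace ℝ (Fin 2) :=
  r • (EuclideanSpace.equiv (Fin 2) ℝ).symm ![Real.cos θ, Real.sin θ]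

lemma circlePt_norm (r θ : ℝ) (hr : 0 < r) : ‖circlePt r θ‖ = r := by
  have : ‖((EuclideanSpace.equiv (Fin 2) ℝ).symm ![Real.cos θ, Real.sin θ] :
      EuclideanSpace ℝ (Fin 2))‖ = 1 := by
    rw [EuclideanSpace.norm_eq]
    simp
  rw [circlePt, norm_smul, this, Real.norm_of_nonneg hr.le, mul_one]

lemma circlePt_hasDerivAt (r θ : ℝ) :
    HasDerivAt (circlePt r) (circlePt r (θ + Real.pi / 2)) θ := by
  have h1 : HasDerivAt (fun t => (![Real.cos t, Real.sin t] : Fin 2 → ℝ))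
      ![Real.cos (θ + Real.pi / 2), Real.sin (θ + Real.pi / 2)] θ := by
    rw [hasDerivAt_pi]
    intro i
    fin_cases i
    · simpa [Real.cos_add_pi_div_two] using Real.hasDerivAt_cos θ
    · simpa [Real.sin_add_pi_div_two] using Real.hasDerivAt_sin θ
  have h2 := ((EuclideanSpace.equiv (Fin 2) ℝ).symm.hasFDerivAt.comp_hasDerivAt θ h1).const_smul r
  exact h2

/-- An `H¹` path, reparametrized quadratically at its starting point, starts with velocity zero. -/
lemma junction_deriv (u : ℝ → EuclideanSpace ℝ (Fin 2)) (hc : ContinuousOn u (Icc 0 1))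
    (hd : ∀ s ∈ Ioo (0:ℝ) 1, DifferentiableAt ℝ u s)
    (hi : IntervalIntegrable (fun s => ‖deriv u s‖ ^ 2) volume 0 1) :
    HasDerivWithinAt (fun s : ℝ => u ((2 * s - 1) ^ 2)) 0 (Ici (1/2)) (1/2) := by
  rw [hasDerivWithinAt_iff_isLittleO, Asymptotics.isLittleO_iff]
  intro c hcpos
  have hcont : ContinuousOn (fun b => ∫ x in (0:ℝ)..b, ‖deriv u x‖ ^ 2) (uIcc 0 1) :=
    continuousOn_primitive_interval' hi left_mem_uIcc
  rw [uIcc_of_le zero_le_one] at hcont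
  have h0 := hcont 0 (by simp)
  have h1 := (Metric.continuousWithinAt_iff.1 h0) ((c/2)^2) (by positivity)
  obtain ⟨δ, hδ, h1⟩ := h1
  have hn : ∀ᶠ s in nhds (1/2 : ℝ), (2 * s - 1) ^ 2 < min δ 1 := by
    have : ContinuousAt (fun s : ℝ => (2 * s - 1) ^ 2) (1/2) := by fun_prop
    apply this.eventually_lt continuousAt_const
    norm_num
    exact hδ
  filter_upwards [nhdsWithin_le_nhds hn, self_mem_nhdsWithin] with s hs hs2
  simp only [mem_Ici] at hs2
  norm_num
  set τ := 2 * s - 1 with hτ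
  have hτ0 : 0 ≤ τ := by rw [hτ]; linarith
  have hsabs : |s - 1/2| = τ / 2 := by
    rw [abs_of_nonneg (by linarith), hτ]; ring
  rw [hsabs]
  rcases hτ0.eq_or_lt with h | hτpos
  · rw [← h]; simp
  have ht1 : τ ^ 2 < 1 := lt_of_lt_of_le hs (min_le_right _ _)
  have htδ : τ ^ 2 < δ := lt_of_lt_of_le hs (min_le_left _ _)
  have htpos : 0 < τ ^ 2 := by positivity
  have hE := h1 (x := τ ^ 2) ⟨htpos.le, ht1.le⟩ (by simpa using htδ)
  simp only [integral_same, dist_zero_right] at hE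
  have hE' : ∫ x in (0:ℝ)..τ ^ 2, ‖deriv u x‖ ^ 2 ≤ (c/2)^2 := (le_abs_self _).trans hE.le
  have hi' : IntervalIntegrable (fun s => ‖deriv u s‖ ^ 2) volume 0 (τ^2) := by
    apply hi.mono_set
    rw [uIcc_of_le zero_le_one, uIcc_of_le htpos.le]
    exact Icc_subset_Icc le_rfl ht1.le
  have key := norm_sub_le_integral_of_norm_deriv_le_of_le (f := u)
    (B := fun t => τ / c * ‖deriv u t‖ ^ 2 + c / (4 * τ)) htpos.le
    (hc.mono (Icc_subset_Icc le_rfl ht1.le))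
    (fun x hx => (hd x ⟨hx.1, hx.2.trans ht1⟩).differentiableWithinAt)
    (Filter.Eventually.of_forall fun t _ => by
      have : 0 ≤ (τ / c) * (‖deriv u t‖ - c / (2 * τ)) ^ 2 := by positivity
      have h3 : (τ / c) * (‖deriv u t‖ - c / (2 * τ)) ^ 2
        = τ / c * ‖deriv u t‖ ^ 2 + c / (4 * τ) - ‖deriv u t‖ := by
        field_simp
        ring
      linarith)
    ((hi'.const_mul _).add (by simp))
  rw [intervalIntegral.integral_add (hi'.const_mul _) (by simp),
    intervalIntegral.integral_const_mul, intervalIntegral.integral_const] at key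
  calc _ ≤ _ := key
    _ ≤ τ / c * (c/2)^2 + (τ^2 - 0) • (c / (4 * τ)) := by gcongr
    _ = c * (τ / 2) := by
      simp only [smul_eq_mul]
      field_simp
      ring

lemma Vpot_continuousAt (α : ℝ) (U : EuclideanSpace ℝ (Fin 2) → ℝ) (hU : Continuous U)
    (x : EuclideanSpace ℝ (Fin 2)) (hx : x ≠ 0) : ContinuousAt (Vpot α U) x := by
  unfold Vpot
  have hx' : ‖x‖ ≠ 0 := by simpa using hx
  apply ContinuousAt.mul
  · exact continuous_norm.continuousAt.rpow_const (Or.inl hx')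
  · apply hU.continuousAt.comp
    exact (continuous_norm.continuousAt.inv₀ hx').smul continuousAt_id

lemma phi_hasDerivAt (s : ℝ) : HasDerivAt (fun s : ℝ => (2 * s - 1) ^ 2) (4 * (2 * s - 1)) s := by
  have := (((hasDerivAt_id s).const_mul 2).sub_const 1).pow 2
  convert! this using 1
  simp; ring

lemma phi_integrable (g : ℝ → ℝ) (hg : IntegrableOn g (Icc 0 1)) :
    IntegrableOn (fun s => (4 * (2 * s - 1)) • g ((2 * s - 1) ^ 2)) (Icc (1/2) 1) := by
  rw [integrableOn_Icc_deriv_smul_iff_of_deriv_nonneg (f := fun s : ℝ => (2 * s - 1) ^ 2)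
    (by fun_prop) (fun x _ => phi_hasDerivAt x) (fun x hx => by linarith [hx.1]) (by norm_num)]
  norm_num
  exact hg

lemma phi_integral (g : ℝ → ℝ) :
    ∫ s in Icc (1/2) 1, (4 * (2 * s - 1)) • g ((2 * s - 1) ^ 2) = ∫ t in Icc 0 1, g t := by
  rw [integral_Icc_deriv_smul_of_deriv_nonneg (f := fun s : ℝ => (2 * s - 1) ^ 2)
    (by fun_prop) (fun x _ => phi_hasDerivAt x) (fun x hx => by linarith [hx.1]) (by norm_num)]
  norm_num

lemma phi_null (P : ℝ → Prop) (h : ∀ᵐ t : ℝ, t ∈ Icc (0:ℝ) 1 → P t) :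
    ∀ᵐ s : ℝ, s ∈ Ioc (1/2 : ℝ) 1 → P ((2 * s - 1) ^ 2) := by
  rw [ae_iff] at h ⊢
  set N : Set ℝ := {t | ¬ (t ∈ Icc (0:ℝ) 1 → P t)} ∩ Ioi 0 with hN
  have hN0 : volume N = 0 := measure_mono_null inter_subset_left h
  have himg : volume ((fun t : ℝ => (1 + Real.sqrt t) / 2) '' N) = 0 := by
    apply addHaar_image_eq_zero_of_differentiableOn_of_addHaar_eq_zero _ _ hN0
    intro t ht
    have : t ≠ 0 := ne_of_gt ht.2
    exact ((((Real.hasDerivAt_sqrt this).differentiableAt).const_add 1).div_const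
      2).differentiableWithinAt
  refine measure_mono_null ?_ himg
  intro s hs
  simp only [mem_ofPred_eq, Classical.not_imp] at hs
  obtain ⟨⟨h1, h2⟩, h3⟩ := hs
  have hp : 0 < 2 * s - 1 := by linarith
  refine ⟨(2 * s - 1) ^ 2, ⟨?_, ?_⟩, ?_⟩
  · simp only [mem_ofPred_eq, Classical.not_imp]
    exact ⟨⟨by positivity, by nlinarith⟩, h3⟩
  · exact pow_pos hp 2
  · simp only []
    rw [Real.sqrt_sq hp.le]; ring

lemma jac_integrable (α h : ℝ) (U : EuclideanSpace ℝ (Fin 2) → ℝ)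
    (u : ℝ → EuclideanSpace ℝ (Fin 2))
    (h1 : IntervalIntegrable (fun s => ‖deriv u s‖ ^ 2) volume 0 1)
    (h2 : IntervalIntegrable (fun s => h + Vpot α U (u s)) volume 0 1) :
    IntervalIntegrable (fun s => ‖deriv u s‖ * Real.sqrt (h + Vpot α U (u s))) volume 0 1 := by
  rw [intervalIntegrable_iff] at *
  refine Integrable.mono' (Integrable.add h1 h2.norm) ?_ ?_
  · exact (stronglyMeasurable_deriv u).norm.aestronglyMeasurable.mul
      (Real.continuous_sqrt.comp_aestronglyMeasurable h2.aestronglyMeasurable)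
  · refine Filter.Eventually.of_forall fun s => ?_
    have hs : Real.sqrt (h + Vpot α U (u s)) ^ 2 ≤ ‖h + Vpot α U (u s)‖ := by
      rcases le_total 0 (h + Vpot α U (u s)) with hp | hp
      · rw [Real.sq_sqrt hp]; exact le_abs_self _
      · rw [Real.sqrt_eq_zero_of_nonpos hp]; simp
    simp only [Pi.add_apply]
    rw [Real.norm_of_nonneg (by positivity)]
    nlinarith [sq_nonneg (‖deriv u s‖ - Real.sqrt (h + Vpot α U (u s))),
      sq_nonneg (‖deriv u s‖), sq_nonneg (Real.sqrt (h + Vpot α U (u s)))]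

/-- Arc from angle `θ₂` to angle `θ₁`, followed by `u`, both reparametrized. -/
noncomputable def joinPath (r θ₁ θ₂ : ℝ) (u : ℝ → EuclideanSpace ℝ (Fin 2)) (s : ℝ) :
    EuclideanSpace ℝ (Fin 2) :=
  if s ≤ 1/2 then circlePt r (θ₂ + (θ₁ - θ₂) * (1 - (2 * s - 1) ^ 2)) else u ((2 * s - 1) ^ 2)

lemma arc_hasDerivAt (r θ₁ θ₂ s : ℝ) :
    HasDerivAt (fun s => circlePt r (θ₂ + (θ₁ - θ₂) * (1 - (2 * s - 1) ^ 2)))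
      (((θ₁ - θ₂) * (-(4 * (2 * s - 1)))) •
        circlePt r (θ₂ + (θ₁ - θ₂) * (1 - (2 * s - 1) ^ 2) + Real.pi / 2)) s :=
  (circlePt_hasDerivAt r _).scomp s
    ((((phi_hasDerivAt s).const_sub 1).const_mul (θ₁ - θ₂)).const_add θ₂)

lemma join_left (r θ₁ θ₂ : ℝ) (u : ℝ → EuclideanSpace ℝ (Fin 2)) (s : ℝ) (hs : s < 1/2) :
    HasDerivAt (joinPath r θ₁ θ₂ u) (((θ₁ - θ₂) * (-(4 * (2 * s - 1)))) •
        circlePt r (θ₂ + (θ₁ - θ₂) * (1 - (2 * s - 1) ^ 2) + Real.pi / 2)) s := by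
  apply (arc_hasDerivAt r θ₁ θ₂ s).congr_of_eventuallyEq
  filter_upwards [Iio_mem_nhds hs] with x hx
  rw [joinPath, if_pos (le_of_lt hx)]

lemma join_right (r θ₁ θ₂ : ℝ) (u : ℝ → EuclideanSpace ℝ (Fin 2))
    (hd : ∀ s ∈ Ioo (0:ℝ) 1, DifferentiableAt ℝ u s) (s : ℝ) (hs : 1/2 < s) (hs1 : s < 1) :
    HasDerivAt (joinPath r θ₁ θ₂ u) ((4 * (2 * s - 1)) • deriv u ((2 * s - 1) ^ 2)) s := by
  have h1 : HasDerivAt u (deriv u ((2 * s - 1) ^ 2)) ((2 * s - 1) ^ 2) :=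
    (hd _ ⟨by nlinarith, by nlinarith⟩).hasDerivAt
  have h2 := h1.scomp s (phi_hasDerivAt s)
  apply h2.congr_of_eventuallyEq
  filter_upwards [Ioi_mem_nhds hs] with x hx
  rw [joinPath, if_neg (not_le.2 hx)]
  rfl

lemma join_eq_right (r θ₁ θ₂ : ℝ) (u : ℝ → EuclideanSpace ℝ (Fin 2)) (h0 : u 0 = circlePt r θ₁)
    (s : ℝ) (hs : 1/2 ≤ s) : joinPath r θ₁ θ₂ u s = u ((2 * s - 1) ^ 2) := by
  rcases hs.eq_or_lt with h | h
  · subst h; simp [joinPath, h0]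
  · rw [joinPath, if_neg (not_le.2 h)]

lemma join_mid (r θ₁ θ₂ : ℝ) (u : ℝ → EuclideanSpace ℝ (Fin 2)) (h0 : u 0 = circlePt r θ₁)
    (hc : ContinuousOn u (Icc 0 1))
    (hd : ∀ s ∈ Ioo (0:ℝ) 1, DifferentiableAt ℝ u s)
    (hi : IntervalIntegrable (fun s => ‖deriv u s‖ ^ 2) volume 0 1) :
    HasDerivAt (joinPath r θ₁ θ₂ u) 0 (1/2) := by
  have hR : HasDerivWithinAt (joinPath r θ₁ θ₂ u) 0 (Ici (1/2)) (1/2) :=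
    (junction_deriv u hc hd hi).congr (fun x hx => join_eq_right r θ₁ θ₂ u h0 x hx)
      (join_eq_right r θ₁ θ₂ u h0 _ le_rfl)
  have hL : HasDerivWithinAt (joinPath r θ₁ θ₂ u) 0 (Iic (1/2)) (1/2) := by
    have := (arc_hasDerivAt r θ₁ θ₂ (1/2)).hasDerivWithinAt (s := Iic (1/2))
    norm_num at this
    norm_num
    refine this.congr (fun x hx => ?_) ?_
    · rw [joinPath, if_pos (by simpa using hx)]
    · rw [joinPath, if_pos (by norm_num)]
  have := hL.union hR
  rwa [Iic_union_Ici, hasDerivWithinAt_univ] at this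

lemma join_mem (α h r : ℝ) (hr : 0 < r) (U : EuclideanSpace ℝ (Fin 2) → ℝ) (hU : Continuous U)
    (θ₁ θ₂ : ℝ) (u : ℝ → EuclideanSpace ℝ (Fin 2)) (hu : HcollQ α h U (circlePt r θ₁) u) :
    HcollQ α h U (circlePt r θ₂) (joinPath r θ₁ θ₂ u) := by
  obtain ⟨hc, hd, h0, h1, hb, hz, hi, hV⟩ := hu
  have hz0 : ∀ s ≤ (1/2 : ℝ), ‖joinPath r θ₁ θ₂ u s‖ = r := fun s hs => by
    rw [joinPath, if_pos hs, circlePt_norm _ _ hr]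
  have hmid := join_mid r θ₁ θ₂ u h0 hc hd hi
  have hdiff : ∀ s < (1:ℝ), DifferentiableAt ℝ (joinPath r θ₁ θ₂ u) s := by
    intro s hs
    rcases lt_trichotomy s (1/2) with h | h | h
    · exact (join_left r θ₁ θ₂ u s h).differentiableAt
    · rw [h]; exact hmid.differentiableAt
    · exact (join_right r θ₁ θ₂ u hd s h hs).differentiableAt
  have hmaps : MapsTo (fun s : ℝ => (2 * s - 1) ^ 2) (Icc (1/2) 1) (Icc 0 1) := fun s hs =>
    ⟨by positivity, by nlinarith [hs.1, hs.2]⟩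
  have hcR : ContinuousOn (fun s : ℝ => u ((2 * s - 1) ^ 2)) (Icc (1/2) 1) :=
    hc.comp (by fun_prop) hmaps
  have hcont : ContinuousOn (joinPath r θ₁ θ₂ u) (Icc 0 1) := by
    intro s hs
    rcases hs.2.lt_or_eq with h | h
    · exact (hdiff s h).continuousAt.continuousWithinAt
    · have h2 : ContinuousWithinAt (joinPath r θ₁ θ₂ u) (Icc (1/2) 1) s :=
        (hcR s (by rw [h]; norm_num)).congr (fun x hx => join_eq_right r θ₁ θ₂ u h0 x hx.1)
          (join_eq_right r θ₁ θ₂ u h0 s (by rw [h]; norm_num))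
      apply h2.mono_of_mem_nhdsWithin
      rw [h]
      have : Ici (1/2 : ℝ) ∈ nhdsWithin 1 (Icc 0 1) :=
        nhdsWithin_le_nhds (Ici_mem_nhds (by norm_num))
      filter_upwards [this, self_mem_nhdsWithin] with x hx hx2
      exact ⟨hx, hx2.2⟩
  refine ⟨hcont, fun s hs => hdiff s hs.2, ?_, ?_, ?_, ?_, ?_, ?_⟩
  · simp [joinPath]
  · rw [join_eq_right _ _ _ _ h0 _ (by norm_num)]; norm_num [h1]
  · intro s hs
    rw [circlePt_norm _ _ hr]
    rcases le_total s (1/2) with h | h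
    · exact (hz0 s h).le
    · rw [join_eq_right _ _ _ _ h0 _ h]
      have := hb _ (hmaps ⟨h, hs.2⟩)
      rwa [circlePt_norm _ _ hr] at this
  · filter_upwards [phi_null (fun t => u t ≠ 0) hz] with s hs hs2
    rcases le_or_gt s (1/2) with h | h
    · intro h3
      have := hz0 s h
      rw [h3, norm_zero] at this
      exact hr.ne this
    · rw [join_eq_right _ _ _ _ h0 _ h.le]
      exact hs ⟨h, hs2.2⟩
  · refine IntervalIntegrable.trans (b := 1/2) ?_ ?_
    · have hI : IntegrableOn (fun s : ℝ => (‖(θ₁ - θ₂) * (-(4 * (2 * s - 1)))‖ * r) ^ 2)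
          (Ioo 0 (1/2)) := by
        apply IntegrableOn.mono_set _ Ioo_subset_Icc_self
        apply ContinuousOn.integrableOn_Icc
        fun_prop
      rw [intervalIntegrable_iff_integrableOn_Ioo_of_le (by norm_num)]
      refine hI.congr_fun (fun s hs => ?_) measurableSet_Ioo
      simp only []
      rw [(join_left r θ₁ θ₂ u s hs.2).deriv, norm_smul, circlePt_norm _ _ hr]
    · rw [intervalIntegrable_iff_integrableOn_Icc_of_le (by norm_num)] at hi
      have hI := (phi_integrable _ hi).continuousOn_mul (g := fun s : ℝ => 4 * (2 * s - 1))
        (by fun_prop) isCompact_Icc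
      rw [intervalIntegrable_iff_integrableOn_Ioo_of_le (by norm_num)]
      refine (hI.mono_set Ioo_subset_Icc_self).congr_fun (fun s hs => ?_) measurableSet_Ioo
      simp only []
      rw [(join_right r θ₁ θ₂ u hd s hs.1 hs.2).deriv, norm_smul, mul_pow, Real.norm_eq_abs, sq_abs,
        smul_eq_mul]
      ring
  · have hcontV : ∀ a b : ℝ, a ≤ b → ContinuousOn (joinPath r θ₁ θ₂ u) (Icc a b) →
        (∀ s ∈ Icc a b, joinPath r θ₁ θ₂ u s ≠ 0) →
        IntervalIntegrable (fun s => h + Vpot α U (joinPath r θ₁ θ₂ u s)) volume a b := by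
      intro a b hab hcc hne
      apply ContinuousOn.intervalIntegrable
      rw [uIcc_of_le hab]
      apply continuousOn_const.add
      intro s hs
      exact (Vpot_continuousAt α U hU _ (hne s hs)).comp_continuousWithinAt (hcc s hs)
    have hev : ∀ᶠ s in nhds (1/2 : ℝ), joinPath r θ₁ θ₂ u s ≠ 0 := by
      apply hmid.continuousAt.eventually_ne
      rw [← norm_ne_zero_iff, hz0 _ le_rfl]; exact hr.ne'
    obtain ⟨δ, hδ, hball⟩ := Metric.eventually_nhds_iff.1 hev
    obtain ⟨b, hb1, hb2⟩ : ∃ b : ℝ, 1/2 < b ∧ b < min 1 (1/2 + δ) :=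
      exists_between (lt_min (by norm_num) (by linarith))
    have hb3 : b < 1 := lt_of_lt_of_le hb2 (min_le_left _ _)
    have hb4 : b < 1/2 + δ := lt_of_lt_of_le hb2 (min_le_right _ _)
    refine IntervalIntegrable.trans (b := b) ?_ ?_
    · apply hcontV _ _ (by linarith) (hcont.mono (Icc_subset_Icc le_rfl hb3.le))
      intro s hs
      rcases le_or_gt s (1/2) with h | h
      · rw [← norm_ne_zero_iff, hz0 _ h]; exact hr.ne'
      · apply hball
        rw [Real.dist_eq, abs_of_pos (by linarith)]
        linarith [hs.2]
    · rw [intervalIntegrable_iff_integrableOn_Icc_of_le (by norm_num)] at hV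
      have hI := ((phi_integrable _ hV).mono_set
        (Icc_subset_Icc (b₁ := 1) (a₁ := b) hb1.le le_rfl)).continuousOn_mul
        (g := fun s : ℝ => (4 * (2 * s - 1))⁻¹)
        (by
          apply ContinuousOn.inv₀ (by fun_prop)
          intro s hs
          have := hs.1
          apply ne_of_gt
          linarith) isCompact_Icc
      rw [intervalIntegrable_iff_integrableOn_Icc_of_le hb3.le]
      refine hI.congr_fun (fun s hs => ?_) measurableSet_Icc
      have hp : (4 * (2 * s - 1)) ≠ 0 := by
        have := hs.1
        apply ne_of_gt
        linarith
      simp only []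
      rw [join_eq_right _ _ _ _ h0 _ (hb1.le.trans hs.1), smul_eq_mul, inv_mul_cancel_left₀ hp]

lemma join_len (α h r Umax : ℝ) (hr : 0 < r) (U : EuclideanSpace ℝ (Fin 2) → ℝ)
    (hU : Continuous U)
    (hUmax : ∀ s : EuclideanSpace ℝ (Fin 2), ‖s‖ = 1 → U s ≤ Umax)
    (θ₁ θ₂ : ℝ) (u : ℝ → EuclideanSpace ℝ (Fin 2)) (hu : HcollQ α h U (circlePt r θ₁) u) :
    JacobiLen α h U (joinPath r θ₁ θ₂ u) ≤
      |θ₁ - θ₂| * r * Real.sqrt (h + r ^ (-α) * Umax) + JacobiLen α h U u := by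
  have hw := join_mem α h r hr U hU θ₁ θ₂ u hu
  obtain ⟨hc, hd, h0, h1, hb, hz, hi, hV⟩ := hu
  obtain ⟨-, -, -, -, -, -, wi, wV⟩ := hw
  have hint := jac_integrable α h U _ wi wV
  have hsub1 : uIcc (0:ℝ) (1/2) ⊆ uIcc 0 1 := by
    rw [uIcc_of_le (by norm_num), uIcc_of_le (by norm_num)]
    exact Icc_subset_Icc (by norm_num) (by norm_num)
  have hsub2 : uIcc (1/2:ℝ) 1 ⊆ uIcc 0 1 := by
    rw [uIcc_of_le (by norm_num), uIcc_of_le (by norm_num)]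
    exact Icc_subset_Icc (by norm_num) (by norm_num)
  have hint1 := hint.mono_set hsub1
  have hint2 := hint.mono_set hsub2
  rw [JacobiLen, ← intervalIntegral.integral_add_adjacent_intervals hint1 hint2]
  apply add_le_add
  · set C := |θ₁ - θ₂| * r * Real.sqrt (h + r ^ (-α) * Umax) with hC
    have hmono : ∫ s in (0:ℝ)..(1/2), ‖deriv (joinPath r θ₁ θ₂ u) s‖ *
        Real.sqrt (h + Vpot α U (joinPath r θ₁ θ₂ u s)) ≤
        ∫ s in (0:ℝ)..(1/2), (4 - 8 * s) * C := by
      apply intervalIntegral.integral_mono_on_of_le_Ioo (by norm_num) hint1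
      · apply Continuous.intervalIntegrable; fun_prop
      · intro s hs
        have hs2 : s < 1/2 := hs.2
        have hn : ‖joinPath r θ₁ θ₂ u s‖ = r := by
          rw [joinPath, if_pos hs2.le, circlePt_norm _ _ hr]
        have hVle : Vpot α U (joinPath r θ₁ θ₂ u s) ≤ r ^ (-α) * Umax := by
          rw [Vpot, hn]
          gcongr
          apply hUmax
          rw [norm_smul, hn, norm_inv, Real.norm_of_nonneg hr.le, inv_mul_cancel₀ hr.ne']
        have hdn : ‖deriv (joinPath r θ₁ θ₂ u) s‖ = (4 - 8 * s) * (|θ₁ - θ₂| * r) := by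
          rw [(join_left r θ₁ θ₂ u s hs2).deriv, norm_smul, circlePt_norm _ _ hr, norm_mul,
            Real.norm_eq_abs, Real.norm_of_nonneg (by linarith : 0 ≤ -(4 * (2 * s - 1)))]
          ring
        rw [hdn, hC, mul_assoc (4 - 8 * s)]
        have : 0 ≤ 4 - 8 * s := by linarith
        gcongr
    refine hmono.trans (le_of_eq ?_)
    rw [intervalIntegral.integral_mul_const]
    have : ∫ s in (0:ℝ)..(1/2), (4 - 8 * s) = 1 := by
      rw [intervalIntegral.integral_sub (by simp) (by apply Continuous.intervalIntegrable; fun_prop),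
        intervalIntegral.integral_const_mul, integral_id]
      norm_num
    rw [this, one_mul]
  · apply le_of_eq
    rw [JacobiLen, intervalIntegral.integral_of_le (by norm_num),
      intervalIntegral.integral_of_le (by norm_num), ← integral_Icc_eq_integral_Ioc,
      ← integral_Icc_eq_integral_Ioc, ← phi_integral, integral_Icc_eq_integral_Ioo,
      integral_Icc_eq_integral_Ioo]
    apply setIntegral_congr_fun measurableSet_Ioo
    intro s hs
    simp only []
    have hs1 : 1/2 < s := hs.1
    rw [(join_right r θ₁ θ₂ u hd s hs.1 hs.2).deriv, norm_smul, join_eq_right _ _ _ _ h0 _ hs1.le,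
      Real.norm_of_nonneg (by linarith), smul_eq_mul, mul_assoc]

lemma jac_nonneg (α h : ℝ) (U : EuclideanSpace ℝ (Fin 2) → ℝ)
    (u : ℝ → EuclideanSpace ℝ (Fin 2)) : 0 ≤ JacobiLen α h U u :=
  intervalIntegral.integral_nonneg (by norm_num) fun s _ => by positivity

lemma const_le (α h r R Umax : ℝ) (hα : α ∈ Set.Ioo (0:ℝ) 2) (hh : h < 0) (hr : 0 < r)
    (hR : r < R) : r * Real.sqrt (h + r ^ (-α) * Umax) ≤ R ^ (1 - α / 2) * Real.sqrt Umax := by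
  have h1 : Real.sqrt (h + r ^ (-α) * Umax) ≤ r ^ (-α / 2) * Real.sqrt Umax := by
    have : r ^ (-α / 2) = Real.sqrt (r ^ (-α)) := by
      rw [Real.sqrt_eq_rpow, ← Real.rpow_mul hr.le]; ring_nf
    rw [this, ← Real.sqrt_mul (by positivity)]
    apply Real.sqrt_le_sqrt
    linarith
  calc r * Real.sqrt (h + r ^ (-α) * Umax) ≤ r * (r ^ (-α / 2) * Real.sqrt Umax) := by gcongr
    _ = r ^ (1 - α / 2) * Real.sqrt Umax := by
      rw [← mul_assoc]
      congr 1
      rw [sub_eq_add_neg, Real.rpow_add hr, Real.rpow_one, neg_div]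
    _ ≤ _ := by
      have : 0 ≤ 1 - α / 2 := by linarith [hα.2]
      gcongr

lemma one_side (α h r R Umax : ℝ) (hα : α ∈ Set.Ioo (0:ℝ) 2) (hh : h < 0) (hr : 0 < r)
    (hR : r < R) (U : EuclideanSpace ℝ (Fin 2) → ℝ) (hU : Continuous U)
    (hUmax : ∀ s : EuclideanSpace ℝ (Fin 2), ‖s‖ = 1 → U s ≤ Umax) (θ₁ θ₂ : ℝ) :
    sInf (JacobiLen α h U '' {u | HcollQ α h U (circlePt r θ₂) u}) ≤
      sInf (JacobiLen α h U '' {u | HcollQ α h U (circlePt r θ₁) u}) +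
      R ^ (1 - α / 2) * Real.sqrt Umax * |θ₁ - θ₂| := by
  have hnn : 0 ≤ R ^ (1 - α / 2) * Real.sqrt Umax * |θ₁ - θ₂| := by
    have : 0 < R := hr.trans hR
    positivity
  have hbdd : ∀ S : Set (ℝ → EuclideanSpace ℝ (Fin 2)), BddBelow (JacobiLen α h U '' S) := by
    intro S
    refine ⟨0, ?_⟩
    rintro _ ⟨u, _, rfl⟩
    exact jac_nonneg α h U u
  rcases Set.eq_empty_or_nonempty {u | HcollQ α h U (circlePt r θ₁) u} with he | hne
  · have he2 : {u | HcollQ α h U (circlePt r θ₂) u} = ∅ := by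
      rw [Set.eq_empty_iff_forall_notMem]
      intro v hv
      have : joinPath r θ₂ θ₁ v ∈ {u | HcollQ α h U (circlePt r θ₁) u} :=
        join_mem α h r hr U hU θ₂ θ₁ v hv
      rw [he] at this
      exact this
    rw [he, he2]
    linarith
  · rw [← sub_le_iff_le_add]
    apply le_csInf (hne.image _)
    rintro _ ⟨u, hu, rfl⟩
    rw [sub_le_iff_le_add]
    have h1 := csInf_le (hbdd _)
      (mem_image_of_mem (JacobiLen α h U)
        (show joinPath r θ₁ θ₂ u ∈ {u | HcollQ α h U (circlePt r θ₂) u} from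
          join_mem α h r hr U hU θ₁ θ₂ u hu))
    have h2 := join_len α h r Umax hr U hU hUmax θ₁ θ₂ u hu
    have h3 := mul_le_mul_of_nonneg_left (const_le α h r R Umax hα hh hr hR) (abs_nonneg (θ₁ - θ₂))
    linarith

/-- Lipschitz estimate for the minimal Jacobi length on `∂B_r`:
`|ω_h(q₁) − ω_h(q₂)| ≤ L |θ₁ − θ₂|` with `L = r_LJ^{1−α/2} √U_max`. -/
theorem jacobi_length_lipschitz
    (α h Umin Umax r : ℝ) (hα : α ∈ Set.Ioo (0:ℝ) 2) (hh : h < 0)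
    (U : EuclideanSpace ℝ (Fin 2) → ℝ) (hUcont : Continuous U)
    (hUmin : ∀ s : EuclideanSpace ℝ (Fin 2), ‖s‖ = 1 → Umin ≤ U s)
    (hUmax : ∀ s : EuclideanSpace ℝ (Fin 2), ‖s‖ = 1 → U s ≤ Umax)
    (hUminpos : 0 < Umin)
    (hr : 0 < r) (hrLJ : r < ((2 - α) * Umin / (-2 * h)) ^ (1/α))
    (θ₁ θ₂ : ℝ) :
    |sInf (JacobiLen α h U '' {u | HcollQ α h U (circlePt r θ₁) u}) -
      sInf (JacobiLen α h U '' {u | HcollQ α h U (circlePt r θ₂) u})| ≤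
      (((2 - α) * Umin / (-2 * h)) ^ (1/α)) ^ (1 - α/2) * Real.sqrt Umax *
        |θ₁ - θ₂| := by

  have h1 := one_side α h r _ Umax hα hh hr hrLJ U hUcont hUmax θ₁ θ₂
  have h2 := one_side α h r _ Umax hα hh hr hrLJ U hUcont hUmax θ₂ θ₁
  rw [abs_sub_comm θ₂ θ₁] at h2
  rw [abs_le]
  constructor <;> linarith
end
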